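/- arXiv:1212.4718 — 4 statements merged into one kernel-verified Lean document; each statement's English description precedes it below -/
import Mathlib

section
/- Let ν > 3, ε₀ ∈ ℝ, and for j ∈ {1,2} set β_j(t) := (j − 1/2)(ν + ε₀ cos(log t)) − 1/2. Fix an integer N ≥ 0 and complex coefficients c̃^{(j)}_{n,m} (0 ≤ m ≤ n ≤ N), and let c_j(t) := Σ_{n=0}^{N} Σ_{m=0}^{n} ε̃_j^n c̃^{(j)}_{n,m} t^{i(n−2m)} be real-valued, where ε̃_j := (j/2 − 1/4)ε₀. Then there exists ε* > 0 (depending on ν, N, and the coefficients) such that for |ε₀| < ε* and any t₀ ∈ (0,1), the equations ((1−a²)∂_a² + (2(β_j(t)−1)a + 2a^{-1})∂_a − β_j(t)² + β_j(t) − t β_j'(t)) q_j(a,t) − (t² ∂_t² q_j(a,t) + 2β_j(t) t ∂_t q_j(a,t)) + 2 a t ∂_a ∂_t q_j(a,t) = c_j(t) a^{2−j} admit solutions q_j ∈ C²({0 < t < t₀, 0 ≤ a ≤ 1}) with q_j(0,t) = ∂_a q_j(0,t) = 0, satisfying for all k ≥ 0 and 0 ≤ ℓ ≤ 2 the bounds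 |∂_t^k ∂_a^ℓ q₂(a,t)| ≤ C_k t^{-k} a^{2−ℓ} and |∂_t^k ∂_a^ℓ q₁(a,t)| ≤ C_k t^{-k} a^{3−ℓ}. -/
noncomputable section

/-- `β_j(t) = (j − 1/2)(ν + ε₀ cos(log t)) − 1/2`. -/
def betaJ (ν ε₀ : ℝ) (j : ℕ) (t : ℝ) : ℝ :=
  ((j : ℝ) - 1 / 2) * (ν + ε₀ * Real.cos (Real.log t)) - 1 / 2

/-- `ε̃_j = (j/2 − 1/4) ε₀`. -/
def epsJ (ε₀ : ℝ) (j : ℕ) : ℝ := ((j : ℝ) / 2 - 1 / 4) * ε₀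

/-- `c_j(t) = Σ_{n=0}^N Σ_{m=0}^n ε̃_j^n c̃^{(j)}_{n,m} t^{i(n−2m)}`. -/
def cJ (ε₀ : ℝ) (N : ℕ) (ctilde : ℕ → ℕ → ℕ → ℂ) (j : ℕ) (t : ℝ) : ℂ :=
  ∑ n ∈ Finset.range (N + 1), ∑ m ∈ Finset.range (n + 1),
    (epsJ ε₀ j : ℂ) ^ n * ctilde j n m *
      Complex.exp (Complex.I * ((n : ℂ) - 2 * (m : ℂ)) * (Real.log t : ℂ))

/-- Mixed partial derivative `∂_a^k ∂_t^l q (a,t)` for `q = q(a,t)`. -/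
def pdat (k l : ℕ) (q : ℝ → ℝ → ℝ) (a t : ℝ) : ℝ :=
  iteratedDeriv k (fun a' => iteratedDeriv l (fun t' => q a' t') t) a

section SelfSimilar

open MeasureTheory Set Filter Topology
open scoped ContDiff

/-! ### Derivatives of functions of `log t` -/

/-- The linear combination of `h 0, …, h k` such that
`∂_t^k (f (log t)) = t⁻ᵏ * logCombo k (fun m => f⁽ᵐ⁾ (log t))`. -/
def logCombo : ℕ → (ℕ → ℝ) → ℝ
  | 0, h => h 0
  | k + 1, h => logCombo k (fun m => h (m + 1)) - k * logCombo k h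

theorem hasDerivAt_logCombo (k : ℕ) {h : ℕ → ℝ → ℝ} {h' : ℕ → ℝ} {x : ℝ}
    (hh : ∀ m, HasDerivAt (h m) (h' m) x) :
    HasDerivAt (fun y => logCombo k (fun m => h m y)) (logCombo k h') x := by
  induction k generalizing h h' with
  | zero => exact hh 0
  | succ k ih => exact (ih fun m => hh (m + 1)).sub ((ih hh).const_mul _)

theorem exists_abs_logCombo_le (k : ℕ) {C : ℕ → ℝ} :
    ∃ D, ∀ (h : ℕ → ℝ) (w : ℝ), (∀ m, |h m| ≤ C m * w) → |logCombo k h| ≤ D * w := by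
  induction k generalizing C with
  | zero => exact ⟨C 0, fun h w hh => hh 0⟩
  | succ k ih =>
    obtain ⟨D₁, h₁⟩ := ih (C := fun m => C (m + 1))
    obtain ⟨D₂, h₂⟩ := ih (C := C)
    refine ⟨D₁ + k * D₂, fun h w hh => ?_⟩
    calc |logCombo k (fun m => h (m + 1)) - k * logCombo k h|
        ≤ |logCombo k (fun m => h (m + 1))| + |k * logCombo k h| := abs_sub _ _
      _ ≤ D₁ * w + k * (D₂ * w) := by
          rw [abs_mul, Nat.abs_cast]
          gcongr
          · exact h₁ _ _ fun m => hh (m + 1)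
          · exact h₂ _ _ hh
      _ = _ := by ring

theorem iteratedDeriv_comp_log {f : ℕ → ℝ → ℝ}
    (hf : ∀ m s, HasDerivAt (f m) (f (m + 1) s) s) (k : ℕ) {t : ℝ} (ht : 0 < t) :
    iteratedDeriv k (fun t => f 0 (Real.log t)) t
      = (t ^ k)⁻¹ * logCombo k (fun m => f m (Real.log t)) := by
  induction k generalizing t with
  | zero => simp [logCombo]
  | succ k ih =>
    have hev : iteratedDeriv k (fun t => f 0 (Real.log t)) =ᶠ[𝓝 t]
        fun t => (t ^ k)⁻¹ * logCombo k (fun m => f m (Real.log t)) := by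
      filter_upwards [lt_mem_nhds ht] with u hu using ih hu
    have hlog : HasDerivAt (fun t => logCombo k (fun m => f m (Real.log t)))
        (logCombo k (fun m => f (m + 1) (Real.log t)) * t⁻¹) t :=
      (hasDerivAt_logCombo k fun m => hf m (Real.log t)).comp t (Real.hasDerivAt_log ht.ne')
    have hpow := (hasDerivAt_pow k t).inv (pow_ne_zero k ht.ne')
    rw [iteratedDeriv_succ, hev.deriv_eq]
    refine (hpow.mul hlog).deriv.trans ?_
    simp only [Pi.inv_apply]
    rcases k with _ | k
    · simp [logCombo]
      ring
    · simp only [logCombo]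
      push_cast
      field_simp
      ring

/-! ### Towers of partial derivatives -/

/-- `Q k i` are the derivatives `∂_s^k ∂_a^i` (`i ≤ 2`) of `Q 0 0`, all continuous, with
`|Q k i| ≤ C a^(n-i)` for `a ∈ [0, 1]`. -/
structure DerivTower (n : ℕ) (Q : ℕ → ℕ → ℝ → ℝ → ℝ) : Prop where
  cont : ∀ k i, i ≤ 2 → Continuous (fun p : ℝ × ℝ => Q k i p.1 p.2)
  deriv_fst : ∀ k i, i < 2 → ∀ a s, HasDerivAt (fun a => Q k i a s) (Q k (i + 1) a s) a
  deriv_snd : ∀ k i, i ≤ 2 → ∀ a s, HasDerivAt (fun s => Q k i a s) (Q (k + 1) i a s) s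
  bound : ∀ k i, i ≤ 2 → ∃ C, ∀ a s, 0 ≤ a → a ≤ 1 → |Q k i a s| ≤ C * a ^ (n - i)

theorem hasFDerivAt_of_continuous_partials {f f₁ f₂ : ℝ → ℝ → ℝ}
    (h₁ : ∀ a s, HasDerivAt (fun a => f a s) (f₁ a s) a)
    (h₂ : ∀ a s, HasDerivAt (fun s => f a s) (f₂ a s) s)
    (c₁ : Continuous (fun p : ℝ × ℝ => f₁ p.1 p.2))
    (c₂ : Continuous (fun p : ℝ × ℝ => f₂ p.1 p.2)) (p : ℝ × ℝ) :
    HasFDerivAt (fun p : ℝ × ℝ => f p.1 p.2)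
      (f₁ p.1 p.2 • ContinuousLinearMap.fst ℝ ℝ ℝ + f₂ p.1 p.2 • ContinuousLinearMap.snd ℝ ℝ ℝ)
      p := by
  have := (hasStrictFDerivAt_uncurry_coprod (𝕜 := ℝ) (u := p) (f := f)
    (f₁ := fun a s => ContinuousLinearMap.toSpanSingleton ℝ (f₁ a s))
    (f₂ := fun a s => ContinuousLinearMap.toSpanSingleton ℝ (f₂ a s))
    (Eventually.of_forall fun v => (h₁ v.1 v.2).hasFDerivAt)
    (Eventually.of_forall fun v => (h₂ v.1 v.2).hasFDerivAt)
    (((ContinuousLinearMap.toSpanSingletonCLE (𝕜 := ℝ) (E := ℝ)).continuous.comp c₁).continuousAt)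
    (((ContinuousLinearMap.toSpanSingletonCLE (𝕜 := ℝ) (E := ℝ)).continuous.comp c₂).continuousAt)
    ).hasFDerivAt
  convert! this using 1
  ext <;> simp [Function.HasUncurry.uncurry]

theorem contDiff_succ_of_partials {m : ℕ} {f f₁ f₂ : ℝ → ℝ → ℝ}
    (h₁ : ∀ a s, HasDerivAt (fun a => f a s) (f₁ a s) a)
    (h₂ : ∀ a s, HasDerivAt (fun s => f a s) (f₂ a s) s)
    (c₁ : ContDiff ℝ m (fun p : ℝ × ℝ => f₁ p.1 p.2))
    (c₂ : ContDiff ℝ m (fun p : ℝ × ℝ => f₂ p.1 p.2)) :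
    ContDiff ℝ (m + 1) (fun p : ℝ × ℝ => f p.1 p.2) := by
  have hd := hasFDerivAt_of_continuous_partials h₁ h₂ c₁.continuous c₂.continuous
  rw [contDiff_succ_iff_fderiv]
  refine ⟨fun p => (hd p).differentiableAt, by simp, ?_⟩
  rw [funext fun p => (hd p).fderiv]
  exact (c₁.smul contDiff_const).add (c₂.smul contDiff_const)

namespace DerivTower

variable {n : ℕ} {Q : ℕ → ℕ → ℝ → ℝ → ℝ}

theorem contDiff_two (hQ : DerivTower n Q) : ContDiff ℝ 2 (fun p : ℝ × ℝ => Q 0 0 p.1 p.2) := by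
  have h1 : ∀ k i, i < 2 → ContDiff ℝ 1 (fun p : ℝ × ℝ => Q k i p.1 p.2) := fun k i hi => by
    have := contDiff_succ_of_partials (m := 0) (hQ.deriv_fst k i hi) (hQ.deriv_snd k i hi.le)
      (contDiff_zero.2 (hQ.cont _ _ hi)) (contDiff_zero.2 (hQ.cont _ _ hi.le))
    simpa using this
  have := contDiff_succ_of_partials (m := 1) (hQ.deriv_fst 0 0 (by simp))
    (hQ.deriv_snd 0 0 (by simp)) (by exact_mod_cast h1 0 1 (by simp))
    (by exact_mod_cast h1 1 0 (by simp))
  exact_mod_cast this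

theorem pdat_comp_log (hQ : DerivTower n Q) (k : ℕ) {i : ℕ} (hi : i ≤ 2) (a : ℝ) {t : ℝ}
    (ht : 0 < t) :
    pdat i k (fun a t => Q 0 0 a (Real.log t)) a t
      = (t ^ k)⁻¹ * logCombo k (fun m => Q m i a (Real.log t)) := by
  have h0 : ∀ a, iteratedDeriv k (fun t => Q 0 0 a (Real.log t)) t
      = (t ^ k)⁻¹ * logCombo k (fun m => Q m 0 a (Real.log t)) := fun a =>
    iteratedDeriv_comp_log (f := fun m s => Q m 0 a s) (fun m s => hQ.deriv_snd m 0 (by simp) a s)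
      k ht
  have hd : ∀ i < 2, ∀ a, HasDerivAt
      (fun a => (t ^ k)⁻¹ * logCombo k (fun m => Q m i a (Real.log t)))
      ((t ^ k)⁻¹ * logCombo k (fun m => Q m (i + 1) a (Real.log t))) a := fun i hi a =>
    (hasDerivAt_logCombo k fun m => hQ.deriv_fst m i hi a _).const_mul _
  unfold pdat
  rw [funext h0]
  induction i generalizing a with
  | zero => simp
  | succ i ih =>
    rw [iteratedDeriv_succ, funext fun a => ih (by omega) a]
    exact (hd i (by omega) a).deriv

theorem exists_abs_pdat_le (hQ : DerivTower n Q) (k : ℕ) :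
    ∃ C : ℝ, ∀ i : ℕ, i ≤ 2 → ∀ a t : ℝ, 0 ≤ a → a ≤ 1 → 0 < t →
      |pdat i k (fun a t => Q 0 0 a (Real.log t)) a t| ≤ C * (t ^ k)⁻¹ * a ^ (n - i) := by
  have key : ∀ i, i ≤ 2 → ∃ C : ℝ, ∀ a t : ℝ, 0 ≤ a → a ≤ 1 → 0 < t →
      |pdat i k (fun a t => Q 0 0 a (Real.log t)) a t| ≤ C * (t ^ k)⁻¹ * a ^ (n - i) := by
    intro i hi
    choose C hC using fun m => hQ.bound m i hi
    obtain ⟨D, hD⟩ := exists_abs_logCombo_le k (C := C)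
    refine ⟨D, fun a t ha0 ha1 ht => ?_⟩
    rw [hQ.pdat_comp_log k hi a ht, abs_mul, abs_of_pos (by positivity : 0 < (t ^ k)⁻¹)]
    have := hD (fun m => Q m i a (Real.log t)) (a ^ (n - i)) fun m => hC m a _ ha0 ha1
    calc _ ≤ (t ^ k)⁻¹ * (D * a ^ (n - i)) := by gcongr
      _ = _ := by ring
  choose! C hC using key
  refine ⟨max (C 0) (max (C 1) (C 2)), fun i hi a t ha0 ha1 ht => (hC i hi a t ha0 ha1 ht).trans ?_⟩
  gcongr
  interval_cases i <;> simp

/-- Multiplication of a tower by `a ^ n`. -/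
def powMul (n : ℕ) (P : ℕ → ℕ → ℝ → ℝ → ℝ) (k i : ℕ) (a s : ℝ) : ℝ :=
  match i with
  | 0 => a ^ n * P k 0 a s
  | 1 => n * a ^ (n - 1) * P k 0 a s + a ^ n * P k 1 a s
  | _ => n * ((n - 1 : ℕ) * a ^ (n - 2)) * P k 0 a s + 2 * (n * a ^ (n - 1)) * P k 1 a s
      + a ^ n * P k 2 a s

theorem pow_mul {P : ℕ → ℕ → ℝ → ℝ → ℝ} (hP : DerivTower 0 P) :
    DerivTower n (powMul n P) where
  cont k i hi := by
    have h0 := hP.cont k 0 (by simp)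
    have h1 := hP.cont k 1 (by simp)
    have h2 := hP.cont k 2 (by simp)
    interval_cases i <;> simp only [powMul] <;> fun_prop
  deriv_fst k i hi a s := by
    have h0 := hP.deriv_fst k 0 (by simp) a s
    have h1 := hP.deriv_fst k 1 (by simp) a s
    have hp := hasDerivAt_pow n a
    have hp' := (hasDerivAt_pow (n - 1) a).const_mul (n : ℝ)
    interval_cases i
    · exact hp.mul h0
    · convert! (hp'.mul h0).add (hp.mul h1) using 1
      simp only [powMul, Nat.sub_sub]
      ring
  deriv_snd k i hi a s := by
    have h0 := hP.deriv_snd k 0 (by simp) a s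
    have h1 := hP.deriv_snd k 1 (by simp) a s
    have h2 := hP.deriv_snd k 2 (by simp) a s
    interval_cases i
    · exact h0.const_mul _
    · exact (h0.const_mul _).add (h1.const_mul _)
    · exact ((h0.const_mul _).add (h1.const_mul _)).add (h2.const_mul _)
  bound k i hi := by
    have hpow : ∀ {m l : ℕ} {a : ℝ}, 0 ≤ a → a ≤ 1 → l ≤ m → a ^ m ≤ a ^ l :=
      fun h0 h1 h => pow_le_pow_of_le_one h0 h1 h
    obtain ⟨C₀, h₀⟩ := hP.bound k 0 (by simp)
    obtain ⟨C₁, h₁⟩ := hP.bound k 1 (by simp)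
    obtain ⟨C₂, h₂⟩ := hP.bound k 2 (by simp)
    simp only [Nat.zero_sub, pow_zero, mul_one] at h₀ h₁ h₂
    have term : ∀ {c x y w C : ℝ}, 0 ≤ c → 0 ≤ x → x ≤ w → |y| ≤ C → |c * x * y| ≤ c * C * w := by
      intro c x y w C hc hx hxw hy
      rw [abs_mul, abs_of_nonneg (mul_nonneg hc hx)]
      have hC : 0 ≤ C := (abs_nonneg y).trans hy
      have hw : 0 ≤ w := hx.trans hxw
      calc c * x * |y| ≤ c * w * C := by gcongr
        _ = _ := by ring
    interval_cases i
    · refine ⟨1 * C₀, fun a s ha0 ha1 => ?_⟩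
      have := term zero_le_one (pow_nonneg ha0 n) le_rfl (h₀ a s ha0 ha1)
      simpa [powMul] using this
    · refine ⟨n * C₀ + 1 * C₁, fun a s ha0 ha1 => ?_⟩
      have e0 := term n.cast_nonneg (pow_nonneg ha0 (n - 1)) le_rfl (h₀ a s ha0 ha1)
      have e1 := term zero_le_one (pow_nonneg ha0 n) (hpow ha0 ha1 (n.sub_le 1)) (h₁ a s ha0 ha1)
      rw [one_mul (a ^ n)] at e1
      rw [add_mul]
      exact (abs_add_le _ _).trans (add_le_add e0 e1)
    · refine ⟨n * (n - 1 : ℕ) * C₀ + 2 * n * C₁ + 1 * C₂, fun a s ha0 ha1 => ?_⟩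
      have e0 := term (mul_nonneg n.cast_nonneg (n - 1).cast_nonneg) (pow_nonneg ha0 (n - 2)) le_rfl
        (h₀ a s ha0 ha1)
      have e1 := term (mul_nonneg zero_le_two n.cast_nonneg) (pow_nonneg ha0 (n - 1))
        (hpow ha0 ha1 (Nat.sub_le_sub_left one_le_two n)) (h₁ a s ha0 ha1)
      have e2 := term zero_le_one (pow_nonneg ha0 n) (hpow ha0 ha1 (n.sub_le 2)) (h₂ a s ha0 ha1)
      rw [one_mul (a ^ n)] at e2
      rw [mul_assoc (n : ℝ)] at e0
      rw [mul_assoc (2 : ℝ)] at e1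
      rw [add_mul, add_mul]
      exact (abs_add_le _ _).trans (add_le_add ((abs_add_le _ _).trans (add_le_add e0 e1)) e2)

end DerivTower

/-! ### Smooth doubly periodic functions -/

/-- Smooth functions on the plane, `2π`-periodic in each variable. -/
structure SmoothPeriodic (M : ℝ × ℝ → ℝ) : Prop where
  contDiff : ContDiff ℝ ∞ M
  periodic_fst : ∀ s x, M (s + 2 * Real.pi, x) = M (s, x)
  periodic_snd : ∀ s x, M (s, x + 2 * Real.pi) = M (s, x)

/-- Partial derivative in the first variable. -/
def dFst (M : ℝ × ℝ → ℝ) (p : ℝ × ℝ) : ℝ := fderiv ℝ M p (1, 0)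

/-- Partial derivative in the second variable. -/
def dSnd (M : ℝ × ℝ → ℝ) (p : ℝ × ℝ) : ℝ := fderiv ℝ M p (0, 1)

/-- `∂_z (z^r M(s, log z)) = z^(r-1) (zDeriv r M)(s, log z)`. -/
def zDeriv (r : ℝ) (M : ℝ × ℝ → ℝ) (p : ℝ × ℝ) : ℝ := r * M p + dSnd M p

namespace SmoothPeriodic

variable {M : ℝ × ℝ → ℝ}

theorem hasDerivAt_fst (hM : SmoothPeriodic M) (s x : ℝ) :
    HasDerivAt (fun s => M (s, x)) (dFst M (s, x)) s :=
  ((hM.contDiff.differentiable (by simp)) (s, x)).hasFDerivAt.comp_hasDerivAt s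
    ((hasDerivAt_id s).prodMk (hasDerivAt_const s x))

theorem hasDerivAt_snd (hM : SmoothPeriodic M) (s x : ℝ) :
    HasDerivAt (fun x => M (s, x)) (dSnd M (s, x)) x :=
  ((hM.contDiff.differentiable (by simp)) (s, x)).hasFDerivAt.comp_hasDerivAt x
    ((hasDerivAt_const x s).prodMk (hasDerivAt_id x))

theorem fderiv_add (c : ℝ × ℝ) (h : ∀ p, M (p + c) = M p) (p : ℝ × ℝ) :
    fderiv ℝ M (p + c) = fderiv ℝ M p := by
  rw [← fderiv_comp_add_right, funext h]

theorem fderiv_apply (hM : SmoothPeriodic M) (v : ℝ × ℝ) :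
    SmoothPeriodic (fun p => fderiv ℝ M p v) where
  contDiff := (hM.contDiff.fderiv_right (m := ∞) (by simp)).clm_apply contDiff_const
  periodic_fst s x := by
    have := fderiv_add (M := M) (2 * Real.pi, 0)
      (fun p => by rw [← hM.periodic_fst p.1 p.2, Prod.add_def]; simp) (s, x)
    simp only [Prod.mk_add_mk, add_zero] at this
    rw [this]
  periodic_snd s x := by
    have := fderiv_add (M := M) (0, 2 * Real.pi)
      (fun p => by rw [← hM.periodic_snd p.1 p.2, Prod.add_def]; simp) (s, x)
    simp only [Prod.mk_add_mk, add_zero] at this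
    rw [this]

theorem dFst (hM : SmoothPeriodic M) : SmoothPeriodic (dFst M) := hM.fderiv_apply _

theorem dSnd (hM : SmoothPeriodic M) : SmoothPeriodic (dSnd M) := hM.fderiv_apply _

theorem zDeriv (hM : SmoothPeriodic M) (r : ℝ) : SmoothPeriodic (zDeriv r M) where
  contDiff := (contDiff_const.mul hM.contDiff).add hM.dSnd.contDiff
  periodic_fst s x := by simp only [_root_.zDeriv, hM.periodic_fst, hM.dSnd.periodic_fst]
  periodic_snd s x := by simp only [_root_.zDeriv, hM.periodic_snd, hM.dSnd.periodic_snd]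

theorem dFst_dSnd (hM : SmoothPeriodic M) :
    _root_.dFst (_root_.dSnd M) = _root_.dSnd (_root_.dFst M) := by
  funext p
  have hd : DifferentiableAt ℝ (fderiv ℝ M) p :=
    (hM.contDiff.fderiv_right (m := ∞) (by simp)).differentiable (by simp) p
  have hsymm : IsSymmSndFDerivAt ℝ M p := by
    apply hM.contDiff.contDiffAt.isSymmSndFDerivAt
    rw [minSmoothness_of_isRCLikeNormedField]
    exact WithTop.coe_le_coe.2 (le_top : (2 : ℕ∞) ≤ ⊤)
  have key : ∀ v w : ℝ × ℝ,
      fderiv ℝ (fun q => fderiv ℝ M q v) p w = fderiv ℝ (fderiv ℝ M) p w v := by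
    intro v w
    rw [fderiv_clm_apply hd (differentiableAt_const v)]
    simp
  unfold _root_.dFst _root_.dSnd
  rw [key, key]
  exact hsymm _ _

theorem zDeriv_dFst (hM : SmoothPeriodic M) (r : ℝ) :
    _root_.dFst (_root_.zDeriv r M) = _root_.zDeriv r (_root_.dFst M) := by
  funext ⟨s, x⟩
  have h1 := ((hM.hasDerivAt_fst s x).const_mul r).add (hM.dSnd.hasDerivAt_fst s x)
  rw [((hM.zDeriv r).hasDerivAt_fst s x).unique h1, hM.dFst_dSnd]
  rfl

theorem exists_abs_le (hM : SmoothPeriodic M) : ∃ B, 0 ≤ B ∧ ∀ p, |M p| ≤ B := by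
  obtain ⟨B, hB⟩ := (isCompact_Icc.prod isCompact_Icc :
    IsCompact (Icc (0 : ℝ) (2 * Real.pi) ×ˢ Icc (0 : ℝ) (2 * Real.pi))).exists_bound_of_continuousOn
      hM.contDiff.continuous.continuousOn
  have hle : ∀ p, |M p| ≤ B := by
    rintro ⟨s, x⟩
    obtain ⟨s', hs', es⟩ := Function.Periodic.exists_mem_Ico₀ (f := fun s => M (s, x))
      (fun s => hM.periodic_fst s x) Real.two_pi_pos s
    obtain ⟨x', hx', ex⟩ := Function.Periodic.exists_mem_Ico₀ (f := fun x => M (s', x))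
      (fun x => hM.periodic_snd s' x) Real.two_pi_pos x
    rw [show M (s, x) = M (s', x') from es.trans ex]
    exact hB _ ⟨Ico_subset_Icc_self hs', Ico_subset_Icc_self hx'⟩
  exact ⟨B, (abs_nonneg _).trans (hle 0), hle⟩

end SmoothPeriodic

/-! ### The integrals `∫₀¹ (1-y)^n y^i (1+ay)^r M(s, log(1+ay)) dy` -/

/-- The integrand of `kerInt`. -/
def kerFun (n i : ℕ) (r : ℝ) (M : ℝ × ℝ → ℝ) (a s y : ℝ) : ℝ :=
  (1 - y) ^ n * y ^ i * ((1 + a * y) ^ r * M (s, Real.log (1 + a * y)))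

/-- `∫₀¹ (1-y)^n y^i (1+ay)^r M(s, log(1+ay)) dy`. -/
def kerInt (n i : ℕ) (r : ℝ) (M : ℝ × ℝ → ℝ) (a s : ℝ) : ℝ :=
  ∫ y in Ioo (0 : ℝ) 1, kerFun n i r M a s y

theorem one_sub_le_one_add_mul {a y : ℝ} (ha : a ∈ Icc (-1 : ℝ) 1) (hy : y ∈ Ioo (0 : ℝ) 1) :
    1 - y ≤ 1 + a * y := by
  nlinarith [ha.1, hy.1]

theorem one_add_mul_pos {a y : ℝ} (ha : a ∈ Icc (-1 : ℝ) 1) (hy : y ∈ Ioo (0 : ℝ) 1) :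
    0 < 1 + a * y := by
  linarith [one_sub_le_one_add_mul ha hy, hy.2]

theorem abs_ker_le {n i : ℕ} {r B : ℝ} {M : ℝ × ℝ → ℝ} (hB : 0 ≤ B) (hM : ∀ p, |M p| ≤ B)
    {a s y : ℝ} (ha : a ∈ Icc (-1 : ℝ) 1) (hy : y ∈ Ioo (0 : ℝ) 1) :
    |kerFun n i r M a s y| ≤ B * ((1 - y) ^ (n + r) + 2 ^ r) := by
  have hz := one_add_mul_pos ha hy
  have hzy := one_sub_le_one_add_mul ha hy
  have h1y : 0 < 1 - y := sub_pos.2 hy.2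
  have hp1 : (1 - y) ^ n ≤ 1 := pow_le_one₀ h1y.le (by linarith [hy.1])
  have hp2 : y ^ i ≤ 1 := pow_le_one₀ hy.1.le hy.2.le
  have hz2 : 1 + a * y ≤ 2 := by nlinarith [ha.2, hy.1, hy.2]
  have hw : (1 - y) ^ n * (1 + a * y) ^ r ≤ (1 - y) ^ (n + r) + 2 ^ r := by
    rcases le_total 0 r with hr | hr
    · calc (1 - y) ^ n * (1 + a * y) ^ r ≤ 1 * 2 ^ r := by gcongr
        _ ≤ _ := by rw [one_mul]; exact le_add_of_nonneg_left (by positivity)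
    · calc (1 - y) ^ n * (1 + a * y) ^ r ≤ (1 - y) ^ n * (1 - y) ^ r := by
            gcongr 1
            exact Real.rpow_le_rpow_of_nonpos h1y hzy hr
        _ = (1 - y) ^ (n + r) := by rw [Real.rpow_add h1y, Real.rpow_natCast]
        _ ≤ _ := le_add_of_nonneg_right (by positivity)
  have hnn : 0 ≤ (1 - y) ^ n * (1 + a * y) ^ r := by positivity
  have hyi : 0 ≤ y ^ i := pow_nonneg hy.1.le i
  calc |kerFun n i r M a s y|
      = (y ^ i * |M (s, Real.log (1 + a * y))|) * ((1 - y) ^ n * (1 + a * y) ^ r) := by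
        rw [kerFun, show (1 - y) ^ n * y ^ i * ((1 + a * y) ^ r * M (s, Real.log (1 + a * y)))
          = (y ^ i * M (s, Real.log (1 + a * y))) * ((1 - y) ^ n * (1 + a * y) ^ r) by ring,
          abs_mul, abs_mul, abs_of_nonneg hnn, abs_of_nonneg hyi]
    _ ≤ (1 * B) * ((1 - y) ^ (n + r) + 2 ^ r) := by
        gcongr
        exact hM _
    _ = _ := by ring

theorem integrableOn_majorant (B : ℝ) {n : ℕ} {r : ℝ} (hr : -1 < n + r) :
    IntegrableOn (fun y : ℝ => B * ((1 - y) ^ (n + r) + 2 ^ r)) (Ioo 0 1) := by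
  have h := (intervalIntegral.intervalIntegrable_rpow' (a := 0) (b := 1) hr).comp_sub_left 1
  simp only [sub_zero, sub_self] at h
  rw [intervalIntegrable_iff, uIoc_of_ge zero_le_one] at h
  exact ((h.mono_set Ioo_subset_Ioc_self).add (integrableOn_const (by simp))).const_mul B

theorem continuousOn_ker {n i : ℕ} {r : ℝ} {M : ℝ × ℝ → ℝ} (hM : SmoothPeriodic M) {a s : ℝ}
    (ha : a ∈ Icc (-1 : ℝ) 1) : ContinuousOn (kerFun n i r M a s) (Ioo 0 1) := by
  have hz : ∀ y ∈ Ioo (0 : ℝ) 1, 1 + a * y ≠ 0 := fun y hy => (one_add_mul_pos ha hy).ne'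
  have hzc : ContinuousOn (fun y : ℝ => 1 + a * y) (Ioo 0 1) := by fun_prop
  exact (by fun_prop : ContinuousOn (fun y : ℝ => (1 - y) ^ n * y ^ i) (Ioo 0 1)).mul
    ((hzc.rpow_const fun y hy => Or.inl (hz y hy)).mul
      (hM.contDiff.continuous.comp_continuousOn (continuousOn_const.prodMk (hzc.log hz))))

theorem aestronglyMeasurable_ker {n i : ℕ} {r : ℝ} {M : ℝ × ℝ → ℝ} (hM : SmoothPeriodic M)
    {a s : ℝ} (ha : a ∈ Icc (-1 : ℝ) 1) :
    AEStronglyMeasurable (kerFun n i r M a s) (volume.restrict (Ioo 0 1)) :=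
  (continuousOn_ker hM ha).aestronglyMeasurable measurableSet_Ioo

theorem integrableOn_ker {n i : ℕ} {r : ℝ} {M : ℝ × ℝ → ℝ} (hM : SmoothPeriodic M)
    (hr : -1 < n + r) {a s : ℝ} (ha : a ∈ Icc (-1 : ℝ) 1) :
    IntegrableOn (kerFun n i r M a s) (Ioo 0 1) := by
  obtain ⟨B, hB0, hB⟩ := hM.exists_abs_le
  refine (integrableOn_majorant B hr).mono' (aestronglyMeasurable_ker hM ha) ?_
  filter_upwards [ae_restrict_mem measurableSet_Ioo] with y hy using abs_ker_le hB0 hB ha hy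

theorem exists_abs_kerInt_le {n i : ℕ} {r : ℝ} {M : ℝ × ℝ → ℝ} (hM : SmoothPeriodic M)
    (hr : -1 < n + r) : ∃ C, ∀ a ∈ Icc (-1 : ℝ) 1, ∀ s, |kerInt n i r M a s| ≤ C := by
  obtain ⟨B, hB0, hB⟩ := hM.exists_abs_le
  refine ⟨∫ y in Ioo (0 : ℝ) 1, B * ((1 - y) ^ (n + r) + 2 ^ r), fun a ha s => ?_⟩
  refine norm_integral_le_of_norm_le (f := kerFun n i r M a s) (integrableOn_majorant B hr) ?_
  filter_upwards [ae_restrict_mem measurableSet_Ioo] with y hy using abs_ker_le hB0 hB ha hy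

theorem continuous_kerInt_comp {n i : ℕ} {r : ℝ} {M : ℝ × ℝ → ℝ} (hM : SmoothPeriodic M)
    (hr : -1 < n + r) {c : ℝ → ℝ} (hc : Continuous c) (hc1 : ∀ a, c a ∈ Icc (-1 : ℝ) 1) :
    Continuous (fun p : ℝ × ℝ => kerInt n i r M (c p.1) p.2) := by
  obtain ⟨B, hB0, hB⟩ := hM.exists_abs_le
  refine continuous_of_dominated (F := fun p : ℝ × ℝ => kerFun n i r M (c p.1) p.2)
    (fun p => aestronglyMeasurable_ker hM (hc1 p.1)) (fun p => ?_)
    (integrableOn_majorant B hr) ?_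
  · filter_upwards [ae_restrict_mem measurableSet_Ioo] with y hy
      using abs_ker_le hB0 hB (hc1 p.1) hy
  · filter_upwards [ae_restrict_mem measurableSet_Ioo] with y hy
    have hz : ∀ p : ℝ × ℝ, 1 + c p.1 * y ≠ 0 := fun p => (one_add_mul_pos (hc1 p.1) hy).ne'
    have hzc : Continuous (fun p : ℝ × ℝ => 1 + c p.1 * y) := by fun_prop
    exact continuous_const.mul ((hzc.rpow_const fun p => Or.inl (hz p)).mul
      (hM.contDiff.continuous.comp (continuous_snd.prodMk (hzc.log hz))))

theorem hasDerivAt_kerInt_snd {n i : ℕ} {r : ℝ} {M : ℝ × ℝ → ℝ} (hM : SmoothPeriodic M)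
    (hr : -1 < n + r) {a : ℝ} (ha : a ∈ Icc (-1 : ℝ) 1) (s : ℝ) :
    HasDerivAt (fun s => kerInt n i r M a s) (kerInt n i r (dFst M) a s) s := by
  obtain ⟨B, hB0, hB⟩ := hM.dFst.exists_abs_le
  refine (hasDerivAt_integral_of_dominated_loc_of_deriv_le (F := fun s => kerFun n i r M a s)
    (F' := fun s => kerFun n i r (dFst M) a s) univ_mem
    (Eventually.of_forall fun s => aestronglyMeasurable_ker hM ha) (integrableOn_ker hM hr ha)
    (aestronglyMeasurable_ker hM.dFst ha) ?_ (integrableOn_majorant B hr) ?_).2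
  · filter_upwards [ae_restrict_mem measurableSet_Ioo] with y hy s _
      using abs_ker_le hB0 hB ha hy
  · filter_upwards with y s _
    exact ((hM.hasDerivAt_fst s _).const_mul _).const_mul _

theorem hasDerivAt_rpow_mul_comp_log {r : ℝ} {M : ℝ × ℝ → ℝ} (hM : SmoothPeriodic M) (s : ℝ)
    {z : ℝ} (hz : 0 < z) :
    HasDerivAt (fun z => z ^ r * M (s, Real.log z))
      (z ^ (r - 1) * zDeriv r M (s, Real.log z)) z := by
  have h1 := Real.hasDerivAt_rpow_const (x := z) (p := r) (Or.inl hz.ne')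
  have h2 := (hM.hasDerivAt_snd s (Real.log z)).comp z (Real.hasDerivAt_log hz.ne')
  convert! h1.mul h2 using 1
  simp only [zDeriv, Function.comp, Real.rpow_sub_one hz.ne']
  field_simp

theorem hasDerivAt_kerInt_fst {n i : ℕ} {r : ℝ} {M : ℝ × ℝ → ℝ} (hM : SmoothPeriodic M)
    (hr : -1 < n + (r - 1)) {a : ℝ} (ha : a ∈ Ioo (-1 : ℝ) 1) (s : ℝ) :
    HasDerivAt (fun a => kerInt n i r M a s)
      (kerInt n (i + 1) (r - 1) (zDeriv r M) a s) a := by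
  obtain ⟨B, hB0, hB⟩ := (hM.zDeriv r).exists_abs_le
  have hnhds : Ioo (-1 : ℝ) 1 ∈ 𝓝 a := isOpen_Ioo.mem_nhds ha
  refine (hasDerivAt_integral_of_dominated_loc_of_deriv_le (F := fun a => kerFun n i r M a s)
    (F' := fun a => kerFun n (i + 1) (r - 1) (zDeriv r M) a s) hnhds
    ?_ (integrableOn_ker hM (by linarith) (Ioo_subset_Icc_self ha))
    (aestronglyMeasurable_ker (hM.zDeriv r) (Ioo_subset_Icc_self ha)) ?_
    (integrableOn_majorant B hr) ?_).2
  · filter_upwards [hnhds] with a ha using aestronglyMeasurable_ker hM (Ioo_subset_Icc_self ha)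
  · filter_upwards [ae_restrict_mem measurableSet_Ioo] with y hy a ha
      using abs_ker_le hB0 hB (Ioo_subset_Icc_self ha) hy
  · filter_upwards [ae_restrict_mem measurableSet_Ioo] with y hy a ha
    have hz := one_add_mul_pos (Ioo_subset_Icc_self ha) hy
    have h := (hasDerivAt_rpow_mul_comp_log (r := r) hM s hz).comp a
      (((hasDerivAt_id a).mul_const y).const_add 1)
    convert! h.const_mul ((1 - y) ^ n * y ^ i) using 1
    simp only [kerFun]
    ring

/-! ### Extension beyond `[-1, 1]` by Taylor polynomials -/

/-- The projection of the real line onto `[-1, 1]`. -/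
def clamp (a : ℝ) : ℝ := max (-1) (min a 1)

theorem clamp_mem (a : ℝ) : clamp a ∈ Icc (-1 : ℝ) 1 :=
  ⟨le_max_left _ _, max_le (by norm_num) (min_le_right _ _)⟩

theorem continuous_clamp : Continuous clamp := by unfold clamp; fun_prop

theorem clamp_of_mem {a : ℝ} (ha : a ∈ Icc (-1 : ℝ) 1) : clamp a = a := by
  rw [clamp, min_eq_left ha.2, max_eq_right ha.1]

theorem clamp_of_one_le {a : ℝ} (ha : 1 ≤ a) : clamp a = 1 := by
  rw [clamp, min_eq_right ha, max_eq_right (by norm_num)]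

theorem clamp_of_le_neg_one {a : ℝ} (ha : a ≤ -1) : clamp a = -1 := by
  rw [clamp, min_eq_left (by linarith), max_eq_left ha]

/-- Extension of `g₀` from `[-1, 1]` by the quadratic Taylor polynomials at `±1` with derivatives
`g₁`, `g₂`. -/
def taylorExt (g₀ g₁ g₂ : ℝ → ℝ) (a : ℝ) : ℝ :=
  g₀ (clamp a) + (a - clamp a) * g₁ (clamp a) + (a - clamp a) ^ 2 / 2 * g₂ (clamp a)

theorem taylorExt_of_mem (g₀ g₁ g₂ : ℝ → ℝ) {a : ℝ} (ha : a ∈ Icc (-1 : ℝ) 1) :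
    taylorExt g₀ g₁ g₂ a = g₀ a := by
  simp [taylorExt, clamp_of_mem ha]

theorem hasDerivAt_of_eventually_ne {f g : ℝ → ℝ} {x : ℝ}
    (hd : ∀ᶠ y in 𝓝[≠] x, HasDerivAt f (g y) y) (hf : ContinuousAt f x) (hg : ContinuousAt g x) :
    HasDerivAt f (g x) x := by
  have hlt := hd.filter_mono (nhdsWithin_mono x fun y (hy : y < x) => hy.ne)
  have hgt := hd.filter_mono (nhdsWithin_mono x fun y (hy : x < y) => hy.ne')
  have hl : HasDerivWithinAt f (g x) (Iic x) x := by
    refine hasDerivWithinAt_Iic_of_tendsto_deriv (s := {y | HasDerivAt f (g y) y})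
      (fun y hy => hy.differentiableAt.differentiableWithinAt) hf.continuousWithinAt hlt ?_
    refine (hg.tendsto.mono_left nhdsWithin_le_nhds).congr' ?_
    filter_upwards [hlt] with y hy using hy.deriv.symm
  have hr : HasDerivWithinAt f (g x) (Ici x) x := by
    refine hasDerivWithinAt_Ici_of_tendsto_deriv (s := {y | HasDerivAt f (g y) y})
      (fun y hy => hy.differentiableAt.differentiableWithinAt) hf.continuousWithinAt hgt ?_
    refine (hg.tendsto.mono_left nhdsWithin_le_nhds).congr' ?_
    filter_upwards [hgt] with y hy using hy.deriv.symm
  simpa using hl.union hr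

theorem continuous_taylorExt {X : Type*} [TopologicalSpace X] {a : X → ℝ} {g₀ g₁ g₂ : X → ℝ → ℝ}
    (ha : Continuous a) (c₀ : Continuous fun x => g₀ x (clamp (a x)))
    (c₁ : Continuous fun x => g₁ x (clamp (a x))) (c₂ : Continuous fun x => g₂ x (clamp (a x))) :
    Continuous fun x => taylorExt (g₀ x) (g₁ x) (g₂ x) (a x) := by
  have h := ha.sub (continuous_clamp.comp ha)
  exact (c₀.add (h.mul c₁)).add (((h.pow 2).div_const 2).mul c₂)

theorem hasDerivAt_taylorExt {g₀ g₁ g₂ : ℝ → ℝ}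
    (hg : ∀ a ∈ Ioo (-1 : ℝ) 1, HasDerivAt g₀ (g₁ a) a) (c₀ : Continuous fun a => g₀ (clamp a))
    (c₁ : Continuous fun a => g₁ (clamp a)) (c₂ : Continuous fun a => g₂ (clamp a)) (a : ℝ) :
    HasDerivAt (taylorExt g₀ g₁ g₂) (taylorExt g₁ g₂ 0 a) a := by
  have hpoly : ∀ c a : ℝ, HasDerivAt (fun a => g₀ c + (a - c) * g₁ c + (a - c) ^ 2 / 2 * g₂ c)
      (g₁ c + (a - c) * g₂ c + (a - c) ^ 2 / 2 * 0) a := fun c a => by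
    have h1 := (hasDerivAt_id a).sub_const c
    convert! ((h1.mul_const (g₁ c)).const_add (g₀ c)).add
      (((h1.pow 2).div_const 2).mul_const (g₂ c))
      using 1
    simp
  have hne : ∀ a : ℝ, a ≠ -1 → a ≠ 1 →
      HasDerivAt (taylorExt g₀ g₁ g₂) (taylorExt g₁ g₂ 0 a) a := by
    intro a hm h1
    rcases lt_or_gt_of_ne hm with hm | hm
    · have h := hpoly (-1) a
      rw [taylorExt, clamp_of_le_neg_one hm.le]
      refine h.congr_of_eventuallyEq ?_
      filter_upwards [gt_mem_nhds hm] with b hb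
      rw [taylorExt, clamp_of_le_neg_one hb.le]
    rcases lt_or_gt_of_ne h1 with h1 | h1
    · rw [taylorExt_of_mem _ _ _ ⟨hm.le, h1.le⟩]
      refine (hg a ⟨hm, h1⟩).congr_of_eventuallyEq ?_
      filter_upwards [isOpen_Ioo.mem_nhds ⟨hm, h1⟩] with b hb
      exact taylorExt_of_mem _ _ _ (Ioo_subset_Icc_self hb)
    · have h := hpoly 1 a
      rw [taylorExt, clamp_of_one_le h1.le]
      refine h.congr_of_eventuallyEq ?_
      filter_upwards [lt_mem_nhds h1] with b hb
      rw [taylorExt, clamp_of_one_le hb.le]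
  have e₀ : Continuous (taylorExt g₀ g₁ g₂) := continuous_taylorExt continuous_id c₀ c₁ c₂
  have e₁ : Continuous (taylorExt g₁ g₂ 0) :=
    continuous_taylorExt (g₂ := fun _ => 0) continuous_id c₁ c₂ continuous_const
  rcases eq_or_ne a (-1) with rfl | hm
  · refine hasDerivAt_of_eventually_ne ?_ e₀.continuousAt e₁.continuousAt
    filter_upwards [self_mem_nhdsWithin,
      nhdsWithin_le_nhds (gt_mem_nhds (show (-1 : ℝ) < 1 by norm_num))]
      with b hb hb' using hne b hb hb'.ne
  rcases eq_or_ne a 1 with rfl | h1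
  · refine hasDerivAt_of_eventually_ne ?_ e₀.continuousAt e₁.continuousAt
    filter_upwards [self_mem_nhdsWithin,
      nhdsWithin_le_nhds (lt_mem_nhds (show (-1 : ℝ) < 1 by norm_num))]
      with b hb hb' using hne b hb'.ne' hb
  · exact hne a hm h1

/-! ### The tower of derivatives of the extended integral -/

/-- `∂_z^i (z^p M(s, log z)) = z^(p-i) (zJet p i M)(s, log z)`. -/
def zJet (p : ℝ) : ℕ → (ℝ × ℝ → ℝ) → ℝ × ℝ → ℝ
  | 0, M => M
  | i + 1, M => zDeriv (p - i) (zJet p i M)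

theorem SmoothPeriodic.zJet {M : ℝ × ℝ → ℝ} (hM : SmoothPeriodic M) (p : ℝ) (i : ℕ) :
    SmoothPeriodic (zJet p i M) := by
  induction i with
  | zero => exact hM
  | succ i ih => exact ih.zDeriv _

theorem SmoothPeriodic.dFst_zJet {M : ℝ × ℝ → ℝ} (hM : SmoothPeriodic M) (p : ℝ) (i : ℕ) :
    _root_.dFst (_root_.zJet p i M) = _root_.zJet p i (_root_.dFst M) := by
  induction i with
  | zero => rfl
  | succ i ih =>
    simp only [_root_.zJet]
    rw [(hM.zJet p i).zDeriv_dFst, ih]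

theorem SmoothPeriodic.iterate_dFst {M : ℝ × ℝ → ℝ} (hM : SmoothPeriodic M) (k : ℕ) :
    SmoothPeriodic (_root_.dFst^[k] M) := by
  induction k with
  | zero => exact hM
  | succ k ih =>
    rw [Function.iterate_succ_apply']
    exact ih.dFst

/-- The `i`-th derivative in `a` of `∫_{-1}^1 (1-|y|)^n (1+ay)^p M(s, log(1+ay)) dy` for `i ≤ 2`. -/
def symInt (n : ℕ) (p : ℝ) (M : ℝ × ℝ → ℝ) (i : ℕ) (s a : ℝ) : ℝ :=
  if i ≤ 2 then kerInt n i (p - i) (zJet p i M) a s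
    + (-1) ^ i * kerInt n i (p - i) (zJet p i M) (-a) s else 0

theorem neg_mem_Icc {a : ℝ} (ha : a ∈ Icc (-1 : ℝ) 1) : -a ∈ Icc (-1 : ℝ) 1 :=
  ⟨by linarith [ha.2], by linarith [ha.1]⟩

section symInt

variable {n : ℕ} {p : ℝ} {M : ℝ × ℝ → ℝ}

theorem exponent_gt (hp : 1 < n + p) {i : ℕ} (hi : i ≤ 2) : -1 < n + (p - i) := by
  have : (i : ℝ) ≤ 2 := by exact_mod_cast hi
  linarith

theorem continuous_symInt_clamp (hM : SmoothPeriodic M) (hp : 1 < n + p) (i : ℕ) :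
    Continuous (fun x : ℝ × ℝ => symInt n p M i x.2 (clamp x.1)) := by
  unfold symInt
  split_ifs with hi
  · exact (continuous_kerInt_comp (hM.zJet p i) (exponent_gt hp hi) continuous_clamp clamp_mem).add
      (continuous_const.mul (continuous_kerInt_comp (c := fun a => -clamp a) (hM.zJet p i)
        (exponent_gt hp hi) continuous_clamp.neg fun a => neg_mem_Icc (clamp_mem a)))
  · exact continuous_const

theorem hasDerivAt_symInt_fst (hM : SmoothPeriodic M) (hp : 1 < n + p) {i : ℕ} (hi : i < 2)
    (s : ℝ) {a : ℝ} (ha : a ∈ Ioo (-1 : ℝ) 1) :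
    HasDerivAt (symInt n p M i s) (symInt n p M (i + 1) s a) a := by
  have hr : -1 < n + (p - i - 1) := by
    have := exponent_gt hp (show i + 1 ≤ 2 from hi)
    push_cast at this
    linarith
  have ha' : -a ∈ Ioo (-1 : ℝ) 1 := ⟨by linarith [ha.2], by linarith [ha.1]⟩
  have h1 := hasDerivAt_kerInt_fst (i := i) (hM.zJet p i) hr ha s
  have h2 := (hasDerivAt_kerInt_fst (i := i) (hM.zJet p i) hr ha' s).comp a (hasDerivAt_neg a)
  have e : symInt n p M i s = fun a => kerInt n i (p - i) (zJet p i M) a s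
    + (-1) ^ i * kerInt n i (p - i) (zJet p i M) (-a) s := by
    funext a
    rw [symInt, if_pos hi.le]
  rw [e, symInt, if_pos (show i + 1 ≤ 2 from hi)]
  convert! h1.add (h2.const_mul ((-1) ^ i)) using 1
  push_cast
  rw [← sub_sub]
  simp only [zJet]
  ring

theorem hasDerivAt_symInt_snd (hM : SmoothPeriodic M) (hp : 1 < n + p) (i : ℕ) (s : ℝ) {a : ℝ}
    (ha : a ∈ Icc (-1 : ℝ) 1) :
    HasDerivAt (fun s => symInt n p M i s a) (symInt n p (dFst M) i s a) s := by
  unfold symInt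
  split_ifs with hi
  · rw [← hM.dFst_zJet]
    exact (hasDerivAt_kerInt_snd (hM.zJet p i) (exponent_gt hp hi) ha s).add
      ((hasDerivAt_kerInt_snd (hM.zJet p i) (exponent_gt hp hi) (neg_mem_Icc ha) s).const_mul _)
  · exact hasDerivAt_const _ _

theorem exists_abs_symInt_le (hM : SmoothPeriodic M) (hp : 1 < n + p) (i : ℕ) :
    ∃ C, ∀ s, ∀ a ∈ Icc (-1 : ℝ) 1, |symInt n p M i s a| ≤ C := by
  unfold symInt
  split_ifs with hi
  · obtain ⟨C, hC⟩ := exists_abs_kerInt_le (i := i) (hM.zJet p i) (exponent_gt hp hi)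
    refine ⟨C + C, fun s a ha => (abs_add_le _ _).trans (add_le_add (hC a ha s) ?_)⟩
    rw [abs_mul, abs_pow, abs_neg, abs_one, one_pow, one_mul]
    exact hC _ (neg_mem_Icc ha) s
  · exact ⟨0, by simp⟩

/-- The functions `∂_s^k ∂_a^i` of `∫_{-1}^1 (1-|y|)^n (1+ay)^p M(s, log(1+ay)) dy`, extended to all
real `a`. -/
def symTower (n : ℕ) (p : ℝ) (M : ℝ × ℝ → ℝ) (k i : ℕ) (a s : ℝ) : ℝ :=
  taylorExt (symInt n p (dFst^[k] M) i s) (symInt n p (dFst^[k] M) (i + 1) s)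
    (symInt n p (dFst^[k] M) (i + 2) s) a

theorem symInt_of_gt (i : ℕ) (hi : 2 < i) (s : ℝ) : symInt n p M i s = 0 := by
  funext a
  simp [symInt, hi.not_ge]

theorem symTower_of_mem (k i : ℕ) {a : ℝ} (ha : a ∈ Icc (-1 : ℝ) 1) (s : ℝ) :
    symTower n p M k i a s = symInt n p (dFst^[k] M) i s a :=
  taylorExt_of_mem _ _ _ ha

theorem derivTower_symTower (hM : SmoothPeriodic M) (hp : 1 < n + p) :
    DerivTower 0 (symTower n p M) where
  cont k i _ := by
    have h := fun i => continuous_symInt_clamp (hM.iterate_dFst k) hp i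
    exact continuous_taylorExt continuous_fst (h i) (h (i + 1)) (h (i + 2))
  deriv_fst k i hi a s := by
    have h : ∀ i, Continuous fun a => symInt n p (dFst^[k] M) i s (clamp a) := fun i =>
      (continuous_symInt_clamp (hM.iterate_dFst k) hp i).comp
        (continuous_id.prodMk continuous_const)
    have := hasDerivAt_taylorExt
      (fun a ha => hasDerivAt_symInt_fst (hM.iterate_dFst k) hp hi s ha)
        (h i) (h (i + 1)) (h (i + 2)) a
    rwa [← symInt_of_gt (i + 1 + 2) (by omega) s] at this
  deriv_snd k i _ a s := by
    have h : ∀ i, HasDerivAt (fun s => symInt n p (dFst^[k] M) i s (clamp a))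
        (symInt n p (dFst^[k + 1] M) i s (clamp a)) s := fun i => by
      rw [Function.iterate_succ_apply']
      exact hasDerivAt_symInt_snd (hM.iterate_dFst k) hp i s (clamp_mem a)
    exact ((h i).add ((h (i + 1)).const_mul _)).add ((h (i + 2)).const_mul _)
  bound k i _ := by
    obtain ⟨C, hC⟩ := exists_abs_symInt_le (hM.iterate_dFst k) hp i
    refine ⟨C, fun a s h0 h1 => ?_⟩
    have ha : a ∈ Icc (-1 : ℝ) 1 := ⟨by linarith, h1⟩
    rw [symTower_of_mem k i ha, Nat.zero_sub, pow_zero, mul_one]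
    exact hC s a ha

end symInt

/-! ### The equation -/

theorem SmoothPeriodic.dSnd_zDeriv {M : ℝ × ℝ → ℝ} (hM : SmoothPeriodic M) (r : ℝ) (q : ℝ × ℝ) :
    _root_.dSnd (_root_.zDeriv r M) q = r * _root_.dSnd M q + _root_.dSnd (_root_.dSnd M) q :=
  ((hM.zDeriv r).hasDerivAt_snd q.1 q.2).unique
    (((hM.hasDerivAt_snd q.1 q.2).const_mul r).add (hM.dSnd.hasDerivAt_snd q.1 q.2))

section Equation

variable {n : ℕ} {p κ : ℝ} {M : ℝ × ℝ → ℝ}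

theorem dSnd_dFst_of_transport (hM : SmoothPeriodic M)
    (hT : ∀ q, dFst M q = dSnd M q - κ * Real.cos q.1 * M q) (q : ℝ × ℝ) :
    dSnd (dFst M) q = dSnd (dSnd M) q - κ * Real.cos q.1 * dSnd M q := by
  have h := (hM.dSnd.hasDerivAt_snd q.1 q.2).sub
    ((hM.hasDerivAt_snd q.1 q.2).const_mul (κ * Real.cos q.1))
  have h' := hM.dFst.hasDerivAt_snd q.1 q.2
  rw [funext fun x => hT (q.1, x)] at h'
  exact h'.unique h

theorem dFst_dFst_of_transport (hM : SmoothPeriodic M)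
    (hT : ∀ q, dFst M q = dSnd M q - κ * Real.cos q.1 * M q) (q : ℝ × ℝ) :
    dFst (dFst M) q = dSnd (dFst M) q + κ * Real.sin q.1 * M q
      - κ * Real.cos q.1 * dFst M q := by
  have h := (hM.dSnd.hasDerivAt_fst q.1 q.2).sub
    (((Real.hasDerivAt_cos q.1).const_mul κ).mul (hM.hasDerivAt_fst q.1 q.2))
  have h' := hM.dFst.hasDerivAt_fst q.1 q.2
  rw [funext fun s => hT (s, q.2)] at h'
  rw [show dFst (dFst M) q = _ from h'.unique h, hM.dFst_dSnd]
  ring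

/-- The wave operator applied to one half of the representation integral is a total derivative. -/
theorem kerInt_wave_identity (hM : SmoothPeriodic M) (hp : 1 < n + p)
    (hT : ∀ q, dFst M q = dSnd M q - κ * Real.cos q.1 * M q) {a β : ℝ}
    (ha : a ∈ Ioo (-1 : ℝ) 1) (s : ℝ) (hβ : β = n + p + κ * Real.cos s) :
    (1 - a ^ 2) * (n * (n - 1) * kerInt n 0 p M a s
        + 2 * n * a * kerInt n 1 (p - 1) (zDeriv p M) a s
        + a ^ 2 * kerInt n 2 (p - 1 - 1) (zDeriv (p - 1) (zDeriv p M)) a s)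
      + (2 * (β - 1) * a ^ 2 + 2) * (n * kerInt n 0 p M a s
        + a * kerInt n 1 (p - 1) (zDeriv p M) a s)
      + a ^ 2 * (-β ^ 2 + β + κ * Real.sin s) * kerInt n 0 p M a s
      - a ^ 2 * (kerInt n 0 p (dFst (dFst M)) a s - kerInt n 0 p (dFst M) a s
        + 2 * β * kerInt n 0 p (dFst M) a s)
      + 2 * a ^ 2 * (n * kerInt n 0 p (dFst M) a s
        + a * kerInt n 1 (p - 1) (zDeriv p (dFst M)) a s)
      = a * zDeriv p M (s, 0) + n * M (s, 0) := by
  have ha' := Ioo_subset_Icc_self ha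
  set Φ : ℝ → ℝ := fun y => -((1 - y) ^ (n + 1) *
    ((1 + y) * (a * ((1 + a * y) ^ (p - 1) * zDeriv p M (s, Real.log (1 + a * y))))
      + n * ((1 + a * y) ^ p * M (s, Real.log (1 + a * y))))) with hΦ
  set Ψ : ℝ → ℝ := fun y =>
    ((1 - a ^ 2) * (n * (n - 1)) + (2 * (β - 1) * a ^ 2 + 2) * n
        + a ^ 2 * (-β ^ 2 + β + κ * Real.sin s)) * kerFun n 0 p M a s y
      + ((1 - a ^ 2) * (2 * n * a) + (2 * (β - 1) * a ^ 2 + 2) * a)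
        * kerFun n 1 (p - 1) (zDeriv p M) a s y
      + (1 - a ^ 2) * a ^ 2 * kerFun n 2 (p - 1 - 1) (zDeriv (p - 1) (zDeriv p M)) a s y
      + (a ^ 2 * (1 - 2 * β + 2 * n)) * kerFun n 0 p (dFst M) a s y
      + (2 * a ^ 3) * kerFun n 1 (p - 1) (zDeriv p (dFst M)) a s y
      + (-a ^ 2) * kerFun n 0 p (dFst (dFst M)) a s y with hΨ
  have i1 := (integrableOn_ker (n := n) (i := 0) (r := p) (s := s) hM (by linarith) ha').const_mul
    ((1 - a ^ 2) * (n * (n - 1)) + (2 * (β - 1) * a ^ 2 + 2) * n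
        + a ^ 2 * (-β ^ 2 + β + κ * Real.sin s))
  have i2 := (integrableOn_ker (n := n) (i := 1) (r := p - 1) (s := s) (hM.zDeriv p)
    (by linarith) ha').const_mul ((1 - a ^ 2) * (2 * n * a) + (2 * (β - 1) * a ^ 2 + 2) * a)
  have i3 := (integrableOn_ker (n := n) (i := 2) (r := p - 1 - 1) (s := s)
    ((hM.zDeriv p).zDeriv (p - 1)) (by linarith) ha').const_mul ((1 - a ^ 2) * a ^ 2)
  have i4 := (integrableOn_ker (n := n) (i := 0) (r := p) (s := s) hM.dFst
    (by linarith) ha').const_mul (a ^ 2 * (1 - 2 * β + 2 * n))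
  have i5 := (integrableOn_ker (n := n) (i := 1) (r := p - 1) (s := s) (hM.dFst.zDeriv p)
    (by linarith) ha').const_mul (2 * a ^ 3)
  have i6 := (integrableOn_ker (n := n) (i := 0) (r := p) (s := s) hM.dFst.dFst
    (by linarith) ha').const_mul (-a ^ 2)
  have hint : IntegrableOn Ψ (Ioo 0 1) := ((((i1.add i2).add i3).add i4).add i5).add i6
  have hz : ∀ y ∈ Icc (0 : ℝ) 1, 0 < 1 + a * y := fun y hy => by nlinarith [ha.1, ha.2, hy.1, hy.2]
  have hderiv : ∀ y ∈ Icc (0 : ℝ) 1, HasDerivAt Φ (Ψ y) y := by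
    intro y hy
    have hzy := hz y hy
    have hl : HasDerivAt (fun y => 1 + a * y) a y := by
      simpa using ((hasDerivAt_id y).const_mul a).const_add 1
    have k0 := (hasDerivAt_rpow_mul_comp_log (r := p) hM s hzy).comp y hl
    have k1 := (hasDerivAt_rpow_mul_comp_log (r := p - 1) (hM.zDeriv p) s hzy).comp y hl
    have hw := ((hasDerivAt_id y).const_sub 1).pow (n + 1)
    have hy1 := (hasDerivAt_id y).const_add 1
    convert! (hw.mul ((hy1.mul (k1.const_mul a)).add (k0.const_mul (n : ℝ)))).neg using 1
    simp only [hΨ, kerFun, Function.comp_apply, id_eq, Nat.add_sub_cancel, Pi.pow_apply,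
      Pi.add_apply, Pi.mul_apply, zDeriv, Real.rpow_sub_one hzy.ne', hM.dSnd_zDeriv]
    rw [dFst_dFst_of_transport hM hT, dSnd_dFst_of_transport hM hT, hT]
    simp only [hβ]
    push_cast
    field_simp
    ring
  have hFTC : ∫ y in Ioo (0 : ℝ) 1, Ψ y = Φ 1 - Φ 0 := by
    rw [← integral_Ioc_eq_integral_Ioo, ← intervalIntegral.integral_of_le zero_le_one]
    refine intervalIntegral.integral_eq_sub_of_hasDerivAt_of_le zero_le_one
      (fun y hy => (hderiv y hy).continuousAt.continuousWithinAt)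
      (fun y hy => hderiv y (Ioo_subset_Icc_self hy)) ?_
    rw [intervalIntegrable_iff_integrableOn_Ioo_of_le zero_le_one]
    exact hint
  have hval : Φ 1 - Φ 0 = a * zDeriv p M (s, 0) + n * M (s, 0) := by
    simp [hΦ]
  have hsum := integral_add' ((((i1.add i2).add i3).add i4).add i5) i6
  rw [integral_add' (((i1.add i2).add i3).add i4) i5, integral_add' ((i1.add i2).add i3) i4,
    integral_add' (i1.add i2) i3, integral_add' i1 i2] at hsum
  change (∫ y in Ioo (0 : ℝ) 1, Ψ y) = _ at hsum
  rw [← hval, ← hFTC, hsum]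
  simp only [integral_const_mul, kerInt]
  ring

theorem powMul_symTower_equation (hn : 2 ≤ n) (hM : SmoothPeriodic M) (hp : 1 < n + p)
    (hT : ∀ q, dFst M q = dSnd M q - κ * Real.cos q.1 * M q) {a β : ℝ}
    (ha : a ∈ Ioc (0 : ℝ) 1) (s : ℝ) (hβ : β = n + p + κ * Real.cos s) :
    let Q := DerivTower.powMul n (symTower n p M)
    (1 - a ^ 2) * Q 0 2 a s + (2 * (β - 1) * a + 2 * a⁻¹) * Q 0 1 a s
      + (-β ^ 2 + β + κ * Real.sin s) * Q 0 0 a s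
      - (Q 2 0 a s - Q 1 0 a s + 2 * β * Q 1 0 a s) + 2 * a * Q 1 1 a s
      = 2 * n * M (s, 0) * a ^ (n - 2) := by
  intro Q
  have hQ : DerivTower n Q := (derivTower_symTower hM hp).pow_mul
  have hc : ∀ k i, i ≤ 2 → Continuous fun a => Q k i a s := fun k i hi =>
    (hQ.cont k i hi).comp (continuous_id.prodMk continuous_const)
  have key : EqOn (fun a => a ^ 2 * (1 - a ^ 2) * Q 0 2 a s
      + (2 * (β - 1) * a ^ 3 + 2 * a) * Q 0 1 a s
      + a ^ 2 * (-β ^ 2 + β + κ * Real.sin s) * Q 0 0 a s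
      - a ^ 2 * (Q 2 0 a s - Q 1 0 a s + 2 * β * Q 1 0 a s) + 2 * a ^ 3 * Q 1 1 a s)
      (fun a => 2 * n * M (s, 0) * a ^ n) (closure (Ioo 0 1)) := by
    refine EqOn.closure (fun a ha => ?_) ?_ (by fun_prop)
    · obtain ⟨m, rfl⟩ := Nat.exists_eq_add_of_le' hn
      have ha1 : a ∈ Icc (-1 : ℝ) 1 := ⟨by linarith [ha.1], ha.2.le⟩
      have h1 := kerInt_wave_identity hM hp hT (a := a) ⟨by linarith [ha.1], ha.2⟩ s hβ
      have h2 := kerInt_wave_identity hM hp hT (a := -a)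
        ⟨by linarith [ha.2], by linarith [ha.1]⟩ s hβ
      simp only [Q, DerivTower.powMul, symTower_of_mem _ _ ha1, symInt, zJet]
      simp only [Function.iterate_succ, Function.iterate_zero, Function.comp_apply, id_eq]
      norm_num
      norm_num at h1 h2
      rw [show p - 2 = p - 1 - 1 by ring]
      linear_combination a ^ (m + 2) * (h1 + h2)
    · have h02 := hc 0 2 le_rfl
      have h01 := hc 0 1 (by simp)
      have h00 := hc 0 0 (by simp)
      have h20 := hc 2 0 (by simp)
      have h10 := hc 1 0 (by simp)
      have h11 := hc 1 1 (by simp)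
      fun_prop
  have h := key (by rw [closure_Ioo zero_ne_one]; exact Ioc_subset_Icc_self ha)
  have ha0 : a ≠ 0 := ha.1.ne'
  apply mul_left_cancel₀ (pow_ne_zero 2 ha0)
  have hpow : a ^ 2 * a ^ (n - 2) = a ^ n := by rw [← pow_add, Nat.add_sub_cancel' hn]
  simp only at h
  rw [← hpow] at h
  have hi : a * a⁻¹ = 1 := mul_inv_cancel₀ ha0
  linear_combination h + 2 * a * Q 0 1 a s * hi

end Equation

/-! ### The profile of the source term -/

/-- The solution of the transport equation `∂_s M = ∂_x M - κ cos s M` with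
`M(s, 0) = C(s) / (2n)`. -/
def profile (n : ℕ) (κ : ℝ) (C : ℝ → ℝ) (q : ℝ × ℝ) : ℝ :=
  Real.exp (κ * (Real.sin (q.1 + q.2) - Real.sin q.1)) * (C (q.1 + q.2) / (2 * n))

section Profile

variable {n : ℕ} {κ : ℝ} {C : ℝ → ℝ}

theorem smoothPeriodic_profile (hC : ContDiff ℝ ∞ C) (hper : ∀ u, C (u + 2 * Real.pi) = C u) :
    SmoothPeriodic (profile n κ C) where
  contDiff := by
    unfold profile
    fun_prop
  periodic_fst s x := by
    simp only [profile, add_right_comm s, hper, Real.sin_add_two_pi]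
  periodic_snd s x := by
    simp only [profile, ← add_assoc, hper, Real.sin_add_two_pi]

theorem dFst_profile (hC : ContDiff ℝ ∞ C) (hper : ∀ u, C (u + 2 * Real.pi) = C u) (q : ℝ × ℝ) :
    dFst (profile n κ C) q
      = dSnd (profile n κ C) q - κ * Real.cos q.1 * profile n κ C q := by
  obtain ⟨s, x⟩ := q
  have hM := smoothPeriodic_profile (n := n) (κ := κ) hC hper
  have hC' := (hC.differentiable (by simp) (s + x)).hasDerivAt
  have hs : HasDerivAt (fun s => s + x) 1 s := (hasDerivAt_id s).add_const x
  have hx : HasDerivAt (fun x => s + x) 1 x := (hasDerivAt_id x).const_add s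
  have h1 := ((((Real.hasDerivAt_sin (s + x)).comp s hs).sub
    (Real.hasDerivAt_sin s)).const_mul κ).exp.mul ((hC'.comp s hs).div_const (2 * n : ℝ))
  have h2 := ((((Real.hasDerivAt_sin (s + x)).comp x hx).sub_const
    (Real.sin s)).const_mul κ).exp.mul ((hC'.comp x hx).div_const (2 * n : ℝ))
  rw [(hM.hasDerivAt_fst s x).unique h1, (hM.hasDerivAt_snd s x).unique h2]
  simp only [profile, Function.comp_apply, Pi.sub_apply]
  ring

theorem profile_zero_right (s : ℝ) : profile n κ C (s, 0) = C s / (2 * n) := by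
  simp [profile]

end Profile

theorem contDiff_cJ_exp (ε₀ : ℝ) (N : ℕ) (ctilde : ℕ → ℕ → ℕ → ℂ) (j : ℕ) :
    ContDiff ℝ ∞ (fun u : ℝ => (cJ ε₀ N ctilde j (Real.exp u)).re) := by
  have h : ContDiff ℝ ∞ (fun u : ℝ => cJ ε₀ N ctilde j (Real.exp u)) := by
    simp only [cJ, Real.log_exp]
    refine ContDiff.sum fun n _ => ContDiff.sum fun m _ => contDiff_const.mul ?_
    exact (contDiff_const.mul Complex.ofRealCLM.contDiff).cexp
  exact Complex.reCLM.contDiff.comp h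

theorem cJ_exp_add_two_pi (ε₀ : ℝ) (N : ℕ) (ctilde : ℕ → ℕ → ℕ → ℂ) (j : ℕ) (u : ℝ) :
    cJ ε₀ N ctilde j (Real.exp (u + 2 * Real.pi)) = cJ ε₀ N ctilde j (Real.exp u) := by
  simp only [cJ, Real.log_exp]
  refine Finset.sum_congr rfl fun n _ => Finset.sum_congr rfl fun m _ => ?_
  congr 1
  rw [Complex.exp_eq_exp_iff_exists_int]
  refine ⟨n - 2 * m, ?_⟩
  push_cast
  ring

theorem mul_deriv_betaJ (ν ε₀ : ℝ) (j : ℕ) {t : ℝ} (ht : 0 < t) :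
    t * deriv (betaJ ν ε₀ j) t = -(((j : ℝ) - 1 / 2) * ε₀ * Real.sin (Real.log t)) := by
  have h := ((((Real.hasDerivAt_log ht.ne').cos.const_mul ε₀).const_add ν).const_mul
    ((j : ℝ) - 1 / 2)).sub_const (1 / 2)
  rw [show deriv (betaJ ν ε₀ j) t = _ from h.deriv]
  field_simp

end SelfSimilar

/-- solvability of the self-similar corrector equations with oscillatory
coefficients (Lemma 1). -/
theorem stmt4 (ν : ℝ) (hν : 3 < ν) (N : ℕ) (ctilde : ℕ → ℕ → ℕ → ℂ) :
    ∃ εstar > (0 : ℝ), ∀ ε₀ : ℝ, |ε₀| < εstar →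
    -- the coefficients c_j are real-valued
    (∀ j ∈ ({1, 2} : Set ℕ), ∀ t : ℝ, 0 < t → (cJ ε₀ N ctilde j t).im = 0) →
    ∀ t₀ : ℝ, 0 < t₀ → t₀ < 1 →
    ∃ q : ℕ → ℝ → ℝ → ℝ, ∀ j ∈ ({1, 2} : Set ℕ),
      -- q_j ∈ C²({0 ≤ a ≤ 1, 0 < t < t₀})
      ContDiffOn ℝ 2 (fun p : ℝ × ℝ => q j p.1 p.2)
        {p : ℝ × ℝ | 0 ≤ p.1 ∧ p.1 ≤ 1 ∧ 0 < p.2 ∧ p.2 < t₀} ∧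
      -- boundary conditions q_j(0,t) = ∂_a q_j(0,t) = 0
      (∀ t : ℝ, 0 < t → t < t₀ → q j 0 t = 0 ∧ pdat 1 0 (q j) 0 t = 0) ∧
      -- the equation
      (∀ a t : ℝ, 0 < a → a ≤ 1 → 0 < t → t < t₀ →
        (1 - a ^ 2) * pdat 2 0 (q j) a t
          + (2 * (betaJ ν ε₀ j t - 1) * a + 2 * a⁻¹) * pdat 1 0 (q j) a t
          + (-(betaJ ν ε₀ j t) ^ 2 + betaJ ν ε₀ j t - t * deriv (betaJ ν ε₀ j) t) * q j a t
          - (t ^ 2 * pdat 0 2 (q j) a t + 2 * betaJ ν ε₀ j t * t * pdat 0 1 (q j) a t)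
          + 2 * a * t * pdat 1 1 (q j) a t
          = (cJ ε₀ N ctilde j t).re * a ^ (2 - j)) ∧
      -- the derivative bounds: |∂_t^k ∂_a^ℓ q_j| ≤ C_k t^{-k} a^{(4−j)−ℓ} for ℓ ≤ 2
      (∀ k : ℕ, ∃ C : ℝ, ∀ ℓ : ℕ, ℓ ≤ 2 → ∀ a t : ℝ, 0 ≤ a → a ≤ 1 → 0 < t → t < t₀ →
        |pdat ℓ k (q j) a t| ≤ C * (t ^ k)⁻¹ * a ^ (4 - j - ℓ)) := by
  refine ⟨1, one_pos, fun ε₀ _ _ t₀ _ _ => ?_⟩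
  let κ : ℕ → ℝ := fun j => ((j : ℝ) - 1 / 2) * ε₀
  let p : ℕ → ℝ := fun j => ((j : ℝ) - 1 / 2) * ν - 1 / 2 - (4 - j : ℕ)
  let M : ℕ → ℝ × ℝ → ℝ := fun j =>
    profile (4 - j) (κ j) fun u => (cJ ε₀ N ctilde j (Real.exp u)).re
  let Q : ℕ → ℕ → ℕ → ℝ → ℝ → ℝ := fun j =>
    DerivTower.powMul (4 - j) (symTower (4 - j) (p j) (M j))
  refine ⟨fun j a t => Q j 0 0 a (Real.log t), fun j hj => ?_⟩
  have hper := fun u => congrArg Complex.re (cJ_exp_add_two_pi ε₀ N ctilde j u)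
  have hM : SmoothPeriodic (M j) := smoothPeriodic_profile (contDiff_cJ_exp ε₀ N ctilde j) hper
  have hT := dFst_profile (n := 4 - j) (κ := κ j) (contDiff_cJ_exp ε₀ N ctilde j) hper
  have hj' : j = 1 ∨ j = 2 := by simpa using hj
  have hp : 1 < ((4 - j : ℕ) : ℝ) + p j := by
    rcases hj' with rfl | rfl <;> norm_num [p] <;> linarith
  have hn : 2 ≤ 4 - j := by omega
  have hQ : DerivTower (4 - j) (Q j) := (derivTower_symTower hM hp).pow_mul
  refine ⟨?_, fun t ht _ => ⟨?_, ?_⟩, fun a t ha ha1 ht _ => ?_, fun k => ?_⟩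
  · have hlog : ContDiffOn ℝ 2 (fun x : ℝ × ℝ => Real.log x.2)
        {x : ℝ × ℝ | 0 ≤ x.1 ∧ x.1 ≤ 1 ∧ 0 < x.2 ∧ x.2 < t₀} :=
      contDiffOn_snd.log fun x hx => hx.2.2.1.ne'
    exact hQ.contDiff_two.comp_contDiffOn (contDiffOn_fst.prodMk hlog)
  · simp [Q, DerivTower.powMul, show 4 - j ≠ 0 by omega]
  · rw [hQ.pdat_comp_log 0 one_le_two 0 ht]
    simp [logCombo, Q, DerivTower.powMul, show 4 - j ≠ 0 by omega, show 4 - j - 1 ≠ 0 by omega]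
  · have hβ : betaJ ν ε₀ j t = ((4 - j : ℕ) : ℝ) + p j + κ j * Real.cos (Real.log t) := by
      simp only [betaJ, p, κ]
      ring
    have h := powMul_symTower_equation hn hM hp hT ⟨ha, ha1⟩ (Real.log t) hβ
    have hn0 : ((4 - j : ℕ) : ℝ) ≠ 0 := Nat.cast_ne_zero.2 (by omega)
    rw [show M j (Real.log t, 0) = _ from profile_zero_right _, Real.exp_log ht,
      show 4 - j - 2 = 2 - j by omega, mul_div_cancel₀ _ (mul_ne_zero two_ne_zero hn0)] at h
    rw [← h, mul_deriv_betaJ ν ε₀ j ht, hQ.pdat_comp_log 0 le_rfl a ht,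
      hQ.pdat_comp_log 0 one_le_two a ht, hQ.pdat_comp_log 2 zero_le_two a ht,
      hQ.pdat_comp_log 1 zero_le_two a ht, hQ.pdat_comp_log 1 one_le_two a ht]
    simp only [logCombo, Q, κ]
    push_cast
    field_simp
    ring
  · obtain ⟨C, hC⟩ := hQ.exists_abs_pdat_le k
    exact ⟨C, fun i hi a t ha0 ha1 ht _ => hC i hi a t ha0 ha1 ht⟩
end
end

section
/- Let ν > 0, τ₀ > 0, let κ : [τ₀,∞) → (0,∞) be continuous with c₁ τ^{1+1/ν} ≤ κ(τ) ≤ c₂ τ^{1+1/ν} for constants 0 < c₁ ≤ c₂, and let ρ : (0,∞) → (0,∞) satisfy d₁ ξ^{-1/2} ≤ ρ(ξ) ≤ d₂ ξ^{-1/2} for 0 < ξ ≤ 1 and d₁ ξ^{1/2} ≤ ρ(ξ) ≤ d₂ ξ^{1/2} for ξ ≥ 1. For τ₀ ≤ τ ≤ σ and ξ > 0 define H_c(τ,σ,ξ) := ξ^{-1/2} (κ(τ)/κ(σ))^{3/2} (ρ((κ(τ)/κ(σ))²ξ)/ρ(ξ))^{1/2} sin(κ(τ) ξ^{1/2} ∫_τ^σ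 κ(u)^{-1} du) and Ĥ_c(τ,σ,ξ) := (κ(τ)/κ(σ))^{3/2} (ρ((κ(τ)/κ(σ))²ξ)/ρ(ξ))^{1/2} cos(κ(τ) ξ^{1/2} ∫_τ^σ κ(u)^{-1} du). Then there is a constant C (depending only on c₁, c₂, d₁, d₂) such that |H_c(τ,σ,ξ)| ≤ C min( ω_ν(τ/σ) ξ^{-1/2}, ν ω_ν(τ/σ) σ ) and |Ĥ_c(τ,σ,ξ)| ≤ C ω_ν(τ/σ), where ω_ν(s) := s^{1+1/ν}. -/
open MeasureTheory

noncomputable section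

/-- The parametrix kernel `H_c(τ,σ,ξ)`. -/
def Hc (κ ρ : ℝ → ℝ) (τ σ ξ : ℝ) : ℝ :=
  ξ ^ (-(1 : ℝ) / 2) * (κ τ / κ σ) ^ ((3 : ℝ) / 2) *
    (ρ ((κ τ / κ σ) ^ 2 * ξ) / ρ ξ) ^ ((1 : ℝ) / 2) *
    Real.sin (κ τ * ξ ^ ((1 : ℝ) / 2) * ∫ u in τ..σ, (κ u)⁻¹)

/-- The differentiated parametrix kernel `Ĥ_c(τ,σ,ξ)`. -/
def Hhat (κ ρ : ℝ → ℝ) (τ σ ξ : ℝ) : ℝ :=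
  (κ τ / κ σ) ^ ((3 : ℝ) / 2) *
    (ρ ((κ τ / κ σ) ^ 2 * ξ) / ρ ξ) ^ ((1 : ℝ) / 2) *
    Real.cos (κ τ * ξ ^ ((1 : ℝ) / 2) * ∫ u in τ..σ, (κ u)⁻¹)

/-- If `ρ ξ * √ξ` is comparable to `max 1 ξ`, then rescaling the argument by `a ^ 2` with
`0 < a ≤ M` changes `ρ` by at most a factor comparable to `a⁻¹`. -/
lemma mul_spectralDensity_rescale_le {d₁ d₂ M a ξ : ℝ} {ρ : ℝ → ℝ} (hd₁ : 0 < d₁) (hd₂ : 0 < d₂)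
    (hM : 1 ≤ M) (ha : 0 < a) (haM : a ≤ M) (hξ : 0 < ξ)
    (hsmall : ∀ ξ : ℝ, 0 < ξ → ξ ≤ 1 →
      d₁ * ξ ^ (-(1 : ℝ) / 2) ≤ ρ ξ ∧ ρ ξ ≤ d₂ * ξ ^ (-(1 : ℝ) / 2))
    (hlarge : ∀ ξ : ℝ, 1 ≤ ξ → d₁ * ξ ^ ((1 : ℝ) / 2) ≤ ρ ξ ∧ ρ ξ ≤ d₂ * ξ ^ ((1 : ℝ) / 2)) :
    a * ρ (a ^ 2 * ξ) ≤ d₂ / d₁ * M ^ 2 * ρ ξ := by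
  have hweight : ∀ x : ℝ, 0 < x →
      d₁ * max 1 x ≤ ρ x * x ^ ((1 : ℝ) / 2) ∧ ρ x * x ^ ((1 : ℝ) / 2) ≤ d₂ * max 1 x := by
    intro x hx
    have hxs : 0 < x ^ ((1 : ℝ) / 2) := by positivity
    rcases le_total x 1 with h | h
    · have hinv : x ^ (-(1 : ℝ) / 2) * x ^ ((1 : ℝ) / 2) = 1 := by
        rw [← Real.rpow_add hx]; norm_num
      obtain ⟨h1, h2⟩ := hsmall x hx h
      have h3 := mul_le_mul_of_nonneg_right h1 hxs.le
      have h4 := mul_le_mul_of_nonneg_right h2 hxs.le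
      rw [mul_assoc, hinv] at h3 h4
      rw [max_eq_left h]
      exact ⟨h3, h4⟩
    · have hsq : x ^ ((1 : ℝ) / 2) * x ^ ((1 : ℝ) / 2) = x := by
        rw [← Real.rpow_add hx]; norm_num
      obtain ⟨h1, h2⟩ := hlarge x h
      have h3 := mul_le_mul_of_nonneg_right h1 hxs.le
      have h4 := mul_le_mul_of_nonneg_right h2 hxs.le
      rw [mul_assoc, hsq] at h3 h4
      rw [max_eq_right h]
      exact ⟨h3, h4⟩
  have hroot : (a ^ 2 * ξ) ^ ((1 : ℝ) / 2) = a * ξ ^ ((1 : ℝ) / 2) := by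
    rw [Real.mul_rpow (by positivity) hξ.le, ← Real.sqrt_eq_rpow, Real.sqrt_sq ha.le]
  have hupper := (hweight (a ^ 2 * ξ) (by positivity)).2
  have hlower := (hweight ξ hξ).1
  rw [hroot] at hupper
  have hmax : max 1 (a ^ 2 * ξ) ≤ M ^ 2 * max 1 ξ := by
    apply max_le
    · exact one_le_mul_of_one_le_of_one_le (one_le_pow₀ hM) (le_max_left _ _)
    · gcongr
      exact le_max_right _ _
  have hξs : 0 < ξ ^ ((1 : ℝ) / 2) := by positivity
  refine le_of_mul_le_mul_right ?_ hξs
  calc a * ρ (a ^ 2 * ξ) * ξ ^ ((1 : ℝ) / 2)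
      = ρ (a ^ 2 * ξ) * (a * ξ ^ ((1 : ℝ) / 2)) := by ring
    _ ≤ d₂ * (M ^ 2 * max 1 ξ) := hupper.trans (by gcongr)
    _ = d₂ / d₁ * M ^ 2 * (d₁ * max 1 ξ) := by field_simp
    _ ≤ d₂ / d₁ * M ^ 2 * (ρ ξ * ξ ^ ((1 : ℝ) / 2)) := by gcongr
    _ = d₂ / d₁ * M ^ 2 * ρ ξ * ξ ^ ((1 : ℝ) / 2) := by ring

lemma rpow_mul_rpow_half_le {a r K : ℝ} (ha : 0 < a) (hr : 0 ≤ r) (hK : 1 ≤ K)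
    (h : a * r ≤ K) : a ^ ((3 : ℝ) / 2) * r ^ ((1 : ℝ) / 2) ≤ K * a := by
  have hsplit : a ^ ((3 : ℝ) / 2) = a * a ^ ((1 : ℝ) / 2) := by
    rw [show (3 : ℝ) / 2 = 1 + 1 / 2 by norm_num, Real.rpow_add ha, Real.rpow_one]
  rw [hsplit, mul_assoc, ← Real.mul_rpow ha.le hr, mul_comm K]
  gcongr
  calc (a * r) ^ ((1 : ℝ) / 2) ≤ K ^ ((1 : ℝ) / 2) := by gcongr
    _ ≤ K ^ (1 : ℝ) := Real.rpow_le_rpow_of_exponent_le hK (by norm_num)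
    _ = K := Real.rpow_one K

lemma integral_rpow_neg_le {ν τ σ : ℝ} (hν : 0 < ν) (hτ : 0 < τ) (hτσ : τ ≤ σ) :
    ∫ u in τ..σ, u ^ (-(1 + 1 / ν)) ≤ ν * τ ^ (-(1 / ν)) := by
  have hν' : 0 < 1 / ν := by positivity
  have hσ : 0 < σ := hτ.trans_le hτσ
  rw [integral_rpow (Or.inr ⟨by linarith, Set.notMem_uIcc_of_lt hτ hσ⟩),
    show -(1 + 1 / ν) + 1 = -(1 / ν) by ring]
  have hσpow : 0 < σ ^ (-(1 / ν)) := by positivity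
  have heq : (σ ^ (-(1 / ν)) - τ ^ (-(1 / ν))) / (-(1 / ν))
      = ν * (τ ^ (-(1 / ν)) - σ ^ (-(1 / ν))) := by
    field_simp
    ring
  rw [heq]
  gcongr
  linarith

/-- The conformal distance `κ(τ) ∫_τ^σ κ⁻¹` is at most a multiple of `ν σ`. -/
lemma mul_integral_inv_le {c₁ c₂ ν τ σ : ℝ} {κ : ℝ → ℝ} (hc₁ : 0 < c₁) (hc₂ : 0 < c₂)
    (hν : 0 < ν) (hτ : 0 < τ) (hτσ : τ ≤ σ) (hcont : ContinuousOn κ (Set.Ici τ))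
    (hκ : ∀ u : ℝ, τ ≤ u → c₁ * u ^ (1 + 1 / ν) ≤ κ u ∧ κ u ≤ c₂ * u ^ (1 + 1 / ν)) :
    κ τ * ∫ u in τ..σ, (κ u)⁻¹ ≤ c₂ / c₁ * (ν * σ) := by
  have hpow : ∀ u, τ ≤ u → 0 < c₁ * u ^ (1 + 1 / ν) := fun u hu => by
    have : 0 < u := hτ.trans_le hu
    positivity
  have hIcc : Set.uIcc τ σ = Set.Icc τ σ := Set.uIcc_of_le hτσ
  have hint : ∫ u in τ..σ, (κ u)⁻¹ ≤ ∫ u in τ..σ, c₁⁻¹ * u ^ (-(1 + 1 / ν)) := by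
    apply intervalIntegral.integral_mono_on hτσ
    · apply ContinuousOn.intervalIntegrable
      rw [hIcc]
      exact (hcont.mono Set.Icc_subset_Ici_self).inv₀
        fun u hu => ((hpow u hu.1).trans_le (hκ u hu.1).1).ne'
    · exact (intervalIntegral.intervalIntegrable_rpow
        (Or.inr (Set.notMem_uIcc_of_lt hτ (hτ.trans_le hτσ)))).const_mul _
    · intro u hu
      rw [Real.rpow_neg (hτ.le.trans hu.1), ← mul_inv]
      exact inv_anti₀ (hpow u hu.1) (hκ u hu.1).1
  rw [intervalIntegral.integral_const_mul] at hint
  have hκτ : 0 ≤ κ τ := (hpow τ le_rfl).le.trans (hκ τ le_rfl).1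
  have hτpow : τ ^ (1 + 1 / ν) * τ ^ (-(1 / ν)) = τ := by
    rw [← Real.rpow_add hτ]; simp
  calc κ τ * ∫ u in τ..σ, (κ u)⁻¹
      ≤ κ τ * (c₁⁻¹ * (ν * τ ^ (-(1 / ν)))) := by
        gcongr
        exact hint.trans (by gcongr; exact integral_rpow_neg_le hν hτ hτσ)
    _ ≤ c₂ * τ ^ (1 + 1 / ν) * (c₁⁻¹ * (ν * τ ^ (-(1 / ν)))) := by
        gcongr
        exact (hκ τ le_rfl).2
    _ = c₂ / c₁ * (ν * (τ ^ (1 + 1 / ν) * τ ^ (-(1 / ν)))) := by ring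
    _ ≤ c₂ / c₁ * (ν * σ) := by rw [hτpow]; gcongr

/-- Lemma on parametrix kernel bounds. -/
theorem stmt8 (c₁ c₂ d₁ d₂ : ℝ) (hc₁ : 0 < c₁) (hc : c₁ ≤ c₂) (hd₁ : 0 < d₁) (hd : d₁ ≤ d₂) :
    ∃ C > (0 : ℝ), ∀ ν : ℝ, 0 < ν → ∀ τ₀ : ℝ, 0 < τ₀ →
    ∀ κ ρ : ℝ → ℝ,
      ContinuousOn κ (Set.Ici τ₀) →
      (∀ τ : ℝ, τ₀ ≤ τ → c₁ * τ ^ (1 + 1 / ν) ≤ κ τ ∧ κ τ ≤ c₂ * τ ^ (1 + 1 / ν)) →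
      (∀ ξ : ℝ, 0 < ξ → 0 < ρ ξ) →
      (∀ ξ : ℝ, 0 < ξ → ξ ≤ 1 → d₁ * ξ ^ (-(1 : ℝ) / 2) ≤ ρ ξ ∧ ρ ξ ≤ d₂ * ξ ^ (-(1 : ℝ) / 2)) →
      (∀ ξ : ℝ, 1 ≤ ξ → d₁ * ξ ^ ((1 : ℝ) / 2) ≤ ρ ξ ∧ ρ ξ ≤ d₂ * ξ ^ ((1 : ℝ) / 2)) →
      ∀ τ σ ξ : ℝ, τ₀ ≤ τ → τ ≤ σ → 0 < ξ →
        |Hc κ ρ τ σ ξ|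
            ≤ C * min ((τ / σ) ^ (1 + 1 / ν) * ξ ^ (-(1 : ℝ) / 2))
                (ν * (τ / σ) ^ (1 + 1 / ν) * σ) ∧
        |Hhat κ ρ τ σ ξ| ≤ C * (τ / σ) ^ (1 + 1 / ν) := by
  have hc₂ : 0 < c₂ := hc₁.trans_le hc
  have hd₂ : 0 < d₂ := hd₁.trans_le hd
  have hM : 1 ≤ c₂ / c₁ := (one_le_div hc₁).2 hc
  have hD : 1 ≤ d₂ / d₁ := (one_le_div hd₁).2 hd
  have hK : 1 ≤ d₂ / d₁ * (c₂ / c₁) ^ 2 :=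
    one_le_mul_of_one_le_of_one_le hD (one_le_pow₀ hM)
  set M := c₂ / c₁ with hM_def
  set K := d₂ / d₁ * M ^ 2 with hK_def
  refine ⟨K * M * M, by positivity, ?_⟩
  intro ν hν τ₀ hτ₀ κ ρ hcont hκ hρ hsmall hlarge τ σ ξ hτ hτσ hξ
  have hτpos : 0 < τ := hτ₀.trans_le hτ
  have hσpos : 0 < σ := hτpos.trans_le hτσ
  have hκpos : ∀ u, τ₀ ≤ u → 0 < κ u := fun u hu => by
    have : 0 < u := hτ₀.trans_le hu
    exact lt_of_lt_of_le (by positivity) (hκ u hu).1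
  have hκτ := hκpos τ hτ
  have hκσ := hκpos σ (hτ.trans hτσ)
  have hω : 0 < (τ / σ) ^ (1 + 1 / ν) := by positivity
  have hω_le : (τ / σ) ^ (1 + 1 / ν) ≤ 1 :=
    Real.rpow_le_one (by positivity) ((div_le_one hσpos).2 hτσ) (by positivity)
  have haω : κ τ / κ σ ≤ M * (τ / σ) ^ (1 + 1 / ν) := by
    rw [Real.div_rpow hτpos.le hσpos.le, hM_def, div_mul_div_comm]
    exact div_le_div₀ (by positivity) (hκ τ hτ).2 (by positivity) (hκ σ (hτ.trans hτσ)).1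
  have hphase := mul_integral_inv_le hc₁ hc₂ hν hτpos hτσ
    (hcont.mono (Set.Ici_subset_Ici.2 hτ)) fun u hu => hκ u (hτ.trans hu)
  rw [← hM_def] at hphase
  have hI : 0 ≤ ∫ u in τ..σ, (κ u)⁻¹ :=
    intervalIntegral.integral_nonneg hτσ fun u hu => (inv_pos.2 (hκpos u (hτ.trans hu.1))).le
  unfold Hc Hhat
  set I := ∫ u in τ..σ, (κ u)⁻¹
  set ω := (τ / σ) ^ (1 + 1 / ν)
  set a := κ τ / κ σ with ha_def
  have ha : 0 < a := by positivity
  have haM : a ≤ M := haω.trans (mul_le_of_le_one_right (by positivity) hω_le)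
  have hρξ := hρ ξ hξ
  have hρa := hρ (a ^ 2 * ξ) (by positivity)
  have hratio : a * (ρ (a ^ 2 * ξ) / ρ ξ) ≤ K := by
    rw [← mul_div_assoc, div_le_iff₀ hρξ]
    exact mul_spectralDensity_rescale_le hd₁ hd₂ hM ha haM hξ hsmall hlarge
  have hpre := (rpow_mul_rpow_half_le ha (by positivity) hK hratio).trans
    (mul_le_mul_of_nonneg_left haω (by positivity))
  rw [mul_assoc (ξ ^ (-(1 : ℝ) / 2))]
  have hpre_nonneg : 0 ≤ a ^ ((3 : ℝ) / 2) * (ρ (a ^ 2 * ξ) / ρ ξ) ^ ((1 : ℝ) / 2) := by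
    positivity
  set P := a ^ ((3 : ℝ) / 2) * (ρ (a ^ 2 * ξ) / ρ ξ) ^ ((1 : ℝ) / 2)
  have hP : P ≤ K * M * M * ω := hpre.trans <| by
    have : K * M * ω ≤ K * M * ω * M := le_mul_of_one_le_right (by positivity) hM
    linarith
  refine ⟨?_, ?_⟩
  · rw [abs_mul, abs_of_nonneg (by positivity : 0 ≤ ξ ^ (-(1 : ℝ) / 2) * P),
      mul_min_of_nonneg _ _ (by positivity : 0 ≤ K * M * M)]
    apply le_min
    · calc ξ ^ (-(1 : ℝ) / 2) * P * |Real.sin (κ τ * ξ ^ ((1 : ℝ) / 2) * I)|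
          ≤ ξ ^ (-(1 : ℝ) / 2) * P :=
            mul_le_of_le_one_right (by positivity) (Real.abs_sin_le_one _)
        _ ≤ ξ ^ (-(1 : ℝ) / 2) * (K * M * M * ω) := by gcongr
        _ = K * M * M * (ω * ξ ^ (-(1 : ℝ) / 2)) := by ring
    · have hcancel : ξ ^ (-(1 : ℝ) / 2) * ξ ^ ((1 : ℝ) / 2) = 1 := by
        rw [← Real.rpow_add hξ]; norm_num
      have hsin : |Real.sin (κ τ * ξ ^ ((1 : ℝ) / 2) * I)| ≤ κ τ * ξ ^ ((1 : ℝ) / 2) * I :=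
        Real.abs_sin_le_abs.trans_eq (abs_of_nonneg (by positivity))
      calc ξ ^ (-(1 : ℝ) / 2) * P * |Real.sin (κ τ * ξ ^ ((1 : ℝ) / 2) * I)|
          ≤ ξ ^ (-(1 : ℝ) / 2) * P * (κ τ * ξ ^ ((1 : ℝ) / 2) * I) := by gcongr
        _ = (ξ ^ (-(1 : ℝ) / 2) * ξ ^ ((1 : ℝ) / 2)) * (P * (κ τ * I)) := by ring
        _ = P * (κ τ * I) := by rw [hcancel, one_mul]
        _ ≤ K * (M * ω) * (M * (ν * σ)) := by gcongr
        _ = K * M * M * (ν * ω * σ) := by ring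
  · rw [abs_mul, abs_of_nonneg hpre_nonneg]
    exact (mul_le_of_le_one_right hpre_nonneg (Real.abs_cos_le_one _)).trans hP
end
end

section
/- Let ν > 0, τ₀ > 0, and let κ : [τ₀,∞) → (0,∞) be continuous with c₁ τ^{1+1/ν} ≤ κ(τ) ≤ c₂ τ^{1+1/ν} for constants 0 < c₁ ≤ c₂. Let a, b, γ ∈ ℝ, q ∈ (1,∞), and α > 1 + 2(1/q + max(|a|, |a+b|))(1 + 1/ν) − γ. Suppose B is measurable with |B(τ,σ,ξ)| ≤ C₀ σ^{-γ} for all τ₀ ≤ τ ≤ σ and ξ ≥ 0, and define 𝓑x(τ,ξ) := ∫_τ^∞ B(τ,σ,ξ) x(σ, (κ(τ)/κ(σ))² ξ) dσ. Then there is a constant C such that ‖ 𝓑x(τ,·) |·|^a ⟨·⟩^b ‖_{L^q(0,∞)} ≤ C τ^{-α-γ+1} sup_{σ>τ} σ^α ‖ x(σ,·) |·|^a ⟨·⟩^b ‖_{L^q(0,∞)} for all τ > τ₀. -/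
open MeasureTheory

noncomputable section

/-- The Japanese bracket `⟨ξ⟩ = (1+ξ²)^{1/2}`. -/
def jb (ξ : ℝ) : ℝ := (1 + ξ ^ 2) ^ ((1 : ℝ) / 2)

open scoped ENNReal

lemma one_le_jb (ξ : ℝ) : 1 ≤ jb ξ :=
  Real.one_le_rpow (by nlinarith [sq_nonneg ξ]) (by norm_num)

lemma jb_pos (ξ : ℝ) : 0 < jb ξ := one_pos.trans_le (one_le_jb ξ)

lemma measurable_jb : Measurable jb := by
  unfold jb
  fun_prop

lemma jb_eq_sqrt (ξ : ℝ) : jb ξ = √(1 + ξ ^ 2) := (Real.sqrt_eq_rpow _).symm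

/-- Scaling by a factor `l ≤ 1` decreases the bracket, by a factor at most `l`. -/
lemma jb_mul_le_of_le_one {l ξ : ℝ} (hl : 0 < l) (hl1 : l ≤ 1) :
    l * jb ξ ≤ jb (l * ξ) ∧ jb (l * ξ) ≤ jb ξ := by
  have h2 : l ^ 2 ≤ 1 := by nlinarith
  simp only [jb_eq_sqrt]
  constructor
  · refine Real.le_sqrt_of_sq_le ?_
    rw [mul_pow, Real.sq_sqrt (by positivity)]
    nlinarith
  · refine Real.sqrt_le_sqrt ?_
    nlinarith [mul_le_mul_of_nonneg_right h2 (sq_nonneg ξ)]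

lemma jb_mul_le_of_one_le {l ξ : ℝ} (hl1 : 1 ≤ l) :
    jb ξ ≤ jb (l * ξ) ∧ jb (l * ξ) ≤ l * jb ξ := by
  have hl : 0 < l := one_pos.trans_le hl1
  have h := jb_mul_le_of_le_one (ξ := l * ξ) (inv_pos.2 hl) (inv_le_one_of_one_le₀ hl1)
  rw [inv_mul_cancel_left₀ hl.ne', inv_mul_le_iff₀ hl] at h
  exact ⟨h.2, h.1⟩

lemma rpow_neg_le_rpow_of_abs_le {l L m c : ℝ} (hl : 0 < l) (hlL : l ≤ L) (hlL' : l⁻¹ ≤ L)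
    (hc : |c| ≤ m) : L ^ (-m) ≤ l ^ c := by
  have hL : 0 < L := hl.trans_le hlL
  have hlog : |Real.log l| ≤ Real.log L := by
    refine abs_le'.2 ⟨Real.log_le_log hl hlL, ?_⟩
    rw [← Real.log_inv]
    exact Real.log_le_log (inv_pos.2 hl) hlL'
  rw [Real.rpow_def_of_pos hL, Real.rpow_def_of_pos hl, Real.exp_le_exp]
  have := mul_le_mul hlog hc (abs_nonneg _) ((abs_nonneg _).trans hlog)
  rw [← abs_mul] at this
  linarith [neg_abs_le (Real.log l * c)]

/-- The weight `ξ ^ a * ⟨ξ⟩ ^ b` changes by a bounded power under dilation. -/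
lemma weight_le_weight_mul {a b l L ξ : ℝ} (hl : 0 < l) (hlL : l ≤ L) (hlL' : l⁻¹ ≤ L)
    (hξ : 0 < ξ) :
    ξ ^ a * jb ξ ^ b ≤ L ^ max |a| |a + b| * ((l * ξ) ^ a * jb (l * ξ) ^ b) := by
  set m := max |a| |a + b|
  have hL : 0 < L := hl.trans_le hlL
  obtain ⟨r, hr, hr1, hrl⟩ : ∃ r, jb (l * ξ) = r * jb ξ ∧ min 1 l ≤ r ∧ r ≤ max 1 l := by
    refine ⟨jb (l * ξ) / jb ξ, (div_mul_cancel₀ _ (jb_pos ξ).ne').symm, ?_, ?_⟩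
    · rw [le_div_iff₀ (jb_pos ξ)]
      rcases le_total l 1 with h | h
      · simpa [h] using (jb_mul_le_of_le_one hl h).1
      · simpa [h] using (jb_mul_le_of_one_le h).1
    · rw [div_le_iff₀ (jb_pos ξ)]
      rcases le_total l 1 with h | h
      · simpa [h] using (jb_mul_le_of_le_one hl h).2
      · simpa [h] using (jb_mul_le_of_one_le h).2
  have hr0 : 0 < r := (lt_min one_pos hl).trans_le hr1
  have hrb : 1 ≤ r ^ b ∨ l ^ b ≤ r ^ b := by
    rcases le_total l 1 with h | h <;> rcases le_total 0 b with hb | hb <;>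
      simp only [h, min_eq_left, min_eq_right, max_eq_left, max_eq_right] at hr1 hrl
    · exact .inr (Real.rpow_le_rpow hl.le hr1 hb)
    · exact .inl (Real.one_le_rpow_of_pos_of_le_one_of_nonpos hr0 hrl hb)
    · exact .inl (Real.one_le_rpow hr1 hb)
    · exact .inr (Real.rpow_le_rpow_of_nonpos hr0 hrl hb)
  have key : L ^ (-m) ≤ l ^ a * r ^ b := by
    rcases hrb with h | h
    · exact (rpow_neg_le_rpow_of_abs_le hl hlL hlL' (le_max_left _ _)).trans
        (le_mul_of_one_le_right (by positivity) h)
    · refine (rpow_neg_le_rpow_of_abs_le hl hlL hlL' (le_max_right _ _)).trans ?_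
      rw [Real.rpow_add hl]
      gcongr
  have key' : 1 ≤ L ^ m * (l ^ a * r ^ b) := by
    rwa [Real.rpow_neg hL.le, inv_le_iff_one_le_mul₀' (by positivity)] at key
  rw [hr, Real.mul_rpow hl.le hξ.le, Real.mul_rpow hr0.le (jb_pos ξ).le]
  have hw : 0 ≤ ξ ^ a * jb ξ ^ b :=
    mul_nonneg (Real.rpow_nonneg hξ.le _) (Real.rpow_nonneg (jb_pos ξ).le _)
  calc ξ ^ a * jb ξ ^ b ≤ L ^ m * (l ^ a * r ^ b) * (ξ ^ a * jb ξ ^ b) :=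
        le_mul_of_one_le_left hw key'
    _ = _ := by ring

lemma setLIntegral_Ioi_comp_mul_left {l : ℝ} (hl : 0 < l) {f : ℝ → ℝ≥0∞} (hf : Measurable f) :
    ∫⁻ ξ in Set.Ioi 0, f (l * ξ) = ENNReal.ofReal l⁻¹ * ∫⁻ ξ in Set.Ioi 0, f ξ := by
  have h := Real.map_volume_mul_left hl.ne'
  rw [← lintegral_indicator measurableSet_Ioi, ← lintegral_indicator measurableSet_Ioi,
    ← abs_of_pos (inv_pos.2 hl), ← smul_eq_mul, ← lintegral_smul_measure, ← h,
    lintegral_map (hf.indicator measurableSet_Ioi) (measurable_const_mul l)]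
  refine lintegral_congr fun ξ => ?_
  simp [Set.indicator_apply, hl]

lemma lintegral_comp_mul_weight_rpow_le {a b q l L : ℝ} (hq : 1 < q) (hl : 0 < l) (hlL : l ≤ L)
    (hlL' : l⁻¹ ≤ L) {y : ℝ → ℝ} (hy : Measurable y) :
    ∫⁻ ξ in Set.Ioi 0, (‖y (l * ξ)‖ₑ * ENNReal.ofReal (ξ ^ a * jb ξ ^ b)) ^ q ≤
      (ENNReal.ofReal (L ^ (1 / q + max |a| |a + b|)) *
        eLpNorm (fun ξ => y ξ * ξ ^ a * jb ξ ^ b) (ENNReal.ofReal q)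
          (volume.restrict (Set.Ioi 0))) ^ q := by
  set m := max |a| |a + b|
  have hL : 0 < L := hl.trans_le hlL
  have hq0 : 0 < q := one_pos.trans hq
  have hjb := measurable_jb
  have hN : eLpNorm (fun ξ => y ξ * ξ ^ a * jb ξ ^ b) (ENNReal.ofReal q)
      (volume.restrict (Set.Ioi 0)) ^ q =
      ∫⁻ ξ in Set.Ioi 0, ‖y ξ * ξ ^ a * jb ξ ^ b‖ₑ ^ q := by
    rw [eLpNorm_eq_lintegral_rpow_enorm_toReal (by simpa using hq0) ENNReal.ofReal_ne_top,
      ENNReal.toReal_ofReal hq0.le, ← ENNReal.rpow_mul, one_div_mul_cancel hq0.ne',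
      ENNReal.rpow_one]
  have hmeas : Measurable fun ξ => ‖y ξ * ξ ^ a * jb ξ ^ b‖ₑ ^ q := by fun_prop
  calc ∫⁻ ξ in Set.Ioi 0, (‖y (l * ξ)‖ₑ * ENNReal.ofReal (ξ ^ a * jb ξ ^ b)) ^ q
      ≤ ∫⁻ ξ in Set.Ioi 0, ENNReal.ofReal (L ^ m) ^ q *
          ‖y (l * ξ) * (l * ξ) ^ a * jb (l * ξ) ^ b‖ₑ ^ q := by
        refine setLIntegral_mono' measurableSet_Ioi fun ξ hξ => ?_
        rw [← ENNReal.mul_rpow_of_nonneg _ _ hq0.le]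
        refine ENNReal.rpow_le_rpow ?_ hq0.le
        have hξ : 0 < ξ := hξ
        have hw : 0 ≤ (l * ξ) ^ a * jb (l * ξ) ^ b :=
          mul_nonneg (Real.rpow_nonneg (by positivity) _) (Real.rpow_nonneg (jb_pos _).le _)
        rw [mul_assoc (y _), enorm_mul, Real.enorm_of_nonneg hw, mul_left_comm,
          ← ENNReal.ofReal_mul (by positivity)]
        gcongr _ * ENNReal.ofReal ?_
        exact weight_le_weight_mul hl hlL hlL' hξ
    _ = ENNReal.ofReal (L ^ m) ^ q * (ENNReal.ofReal l⁻¹ *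
          ∫⁻ ξ in Set.Ioi 0, ‖y ξ * ξ ^ a * jb ξ ^ b‖ₑ ^ q) := by
        rw [lintegral_const_mul _ (by fun_prop), setLIntegral_Ioi_comp_mul_left hl hmeas]
    _ ≤ ENNReal.ofReal (L ^ m) ^ q * (ENNReal.ofReal L *
          ∫⁻ ξ in Set.Ioi 0, ‖y ξ * ξ ^ a * jb ξ ^ b‖ₑ ^ q) := by gcongr
    _ = _ := by
        have hpow : L = (L ^ (1 / q)) ^ q := by
          rw [← Real.rpow_mul hL.le, one_div_mul_cancel hq0.ne', Real.rpow_one]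
        have hsplit : ENNReal.ofReal L = ENNReal.ofReal (L ^ (1 / q)) ^ q := by
          rw [ENNReal.ofReal_rpow_of_nonneg (by positivity) hq0.le, ← hpow]
        rw [ENNReal.mul_rpow_of_nonneg _ _ hq0.le, hN, hsplit, ← mul_assoc,
          ← ENNReal.mul_rpow_of_nonneg _ _ hq0.le, ← ENNReal.ofReal_mul (by positivity),
          ← Real.rpow_add hL, add_comm]

/-- Minkowski's integral inequality, in the form of a bound by a positive majorant. -/
lemma lintegral_lintegral_rpow_le {X Y : Type*} [MeasurableSpace X] [MeasurableSpace Y]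
    {μ : Measure X} {ν : Measure Y} [SFinite μ] [SFinite ν] {q : ℝ} (hq : 1 < q)
    {f : X → Y → ℝ≥0∞} (hf : Measurable (Function.uncurry f)) {g : X → ℝ≥0∞} (hg : Measurable g)
    (hg0 : ∀ᵐ σ ∂μ, g σ ≠ 0) (hgtop : ∀ᵐ σ ∂μ, g σ ≠ ∞) {S : ℝ≥0∞}
    (hfg : ∀ᵐ σ ∂μ, ∫⁻ ξ, f σ ξ ^ q ∂ν ≤ (g σ * S) ^ q) :
    ∫⁻ ξ, (∫⁻ σ, f σ ξ ∂μ) ^ q ∂ν ≤ ((∫⁻ σ, g σ ∂μ) * S) ^ q := by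
  have hq0 : 0 < q := one_pos.trans hq
  have hf1 : ∀ σ, Measurable (f σ) := fun σ => hf.of_uncurry_left
  have hf2 : ∀ ξ, Measurable fun σ => f σ ξ := fun ξ => hf.of_uncurry_right
  have hpt : ∀ ξ, (∫⁻ σ, f σ ξ ∂μ) ^ q ≤
      (∫⁻ σ, f σ ξ ^ q * g σ ^ (1 - q) ∂μ) * (∫⁻ σ, g σ ∂μ) ^ (q - 1) := by
    intro ξ
    have hq1 : 1 / q ≤ 1 := (div_le_one hq0).2 hq.le
    have h := ENNReal.lintegral_mul_norm_pow_le (μ := μ)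
      (f := fun σ => f σ ξ ^ q * g σ ^ (1 - q)) (g := g) (p := 1 / q) (q := 1 - 1 / q)
      (((hf2 ξ).pow_const _).mul (hg.pow_const _)).aemeasurable hg.aemeasurable
      (by positivity) (by linarith) (by ring)
    have heq : ∫⁻ σ, (f σ ξ ^ q * g σ ^ (1 - q)) ^ (1 / q) * g σ ^ (1 - 1 / q) ∂μ =
        ∫⁻ σ, f σ ξ ∂μ := by
      refine lintegral_congr_ae ?_
      filter_upwards [hg0, hgtop] with σ h0 ht
      rw [ENNReal.mul_rpow_of_nonneg _ _ (by positivity), ← ENNReal.rpow_mul, ← ENNReal.rpow_mul,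
        mul_one_div_cancel hq0.ne', ENNReal.rpow_one, mul_assoc, ← ENNReal.rpow_add _ _ h0 ht,
        show (1 - q) * (1 / q) + (1 - 1 / q) = 0 by field_simp; ring, ENNReal.rpow_zero, mul_one]
    rw [heq] at h
    refine (ENNReal.rpow_le_rpow h hq0.le).trans_eq ?_
    rw [ENNReal.mul_rpow_of_nonneg _ _ hq0.le, ← ENNReal.rpow_mul, ← ENNReal.rpow_mul,
      one_div_mul_cancel hq0.ne', ENNReal.rpow_one, sub_mul, one_div_mul_cancel hq0.ne', one_mul]
  have hm : Measurable (Function.uncurry fun ξ σ => f σ ξ ^ q * g σ ^ (1 - q)) :=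
    ((hf.comp measurable_swap).pow_const q).mul ((hg.comp measurable_snd).pow_const (1 - q))
  have hm' : Measurable fun ξ => ∫⁻ σ, f σ ξ ^ q * g σ ^ (1 - q) ∂μ := hm.lintegral_prod_right'
  calc ∫⁻ ξ, (∫⁻ σ, f σ ξ ∂μ) ^ q ∂ν
      ≤ ∫⁻ ξ, (∫⁻ σ, f σ ξ ^ q * g σ ^ (1 - q) ∂μ) * (∫⁻ σ, g σ ∂μ) ^ (q - 1) ∂ν :=
        lintegral_mono hpt
    _ = (∫⁻ σ, (∫⁻ ξ, f σ ξ ^ q ∂ν) * g σ ^ (1 - q) ∂μ) * (∫⁻ σ, g σ ∂μ) ^ (q - 1) := by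
        rw [lintegral_mul_const _ hm', lintegral_lintegral_swap hm.aemeasurable]
        simp_rw [lintegral_mul_const _ ((hf1 _).pow_const q)]
    _ ≤ (∫⁻ σ, g σ * S ^ q ∂μ) * (∫⁻ σ, g σ ∂μ) ^ (q - 1) := by
        refine mul_le_mul_left ?_ _
        refine lintegral_mono_ae ?_
        filter_upwards [hg0, hgtop, hfg] with σ h0 ht h
        refine (mul_le_mul_left h _).trans_eq ?_
        rw [ENNReal.mul_rpow_of_nonneg _ _ hq0.le, mul_right_comm, ← ENNReal.rpow_add _ _ h0 ht,
          add_sub_cancel, ENNReal.rpow_one]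
    _ = ((∫⁻ σ, g σ ∂μ) * S) ^ q := by
        rw [lintegral_mul_const _ hg, ENNReal.mul_rpow_of_nonneg _ _ hq0.le, mul_right_comm]
        congr 1
        nth_rw 1 [← ENNReal.rpow_one (∫⁻ σ, g σ ∂μ)]
        rw [← ENNReal.rpow_add_of_nonneg _ _ zero_le_one (by linarith), add_sub_cancel]

/-- Two values of a function comparable to `τ ^ k` have comparable ratios. -/
lemma div_le_of_rpow_bounds {c₁ c₂ k s t u v : ℝ} (hc₁ : 0 < c₁) (hs : 0 < s) (ht : 0 < t)
    (hc₂ : 0 ≤ c₂) (hu : u ≤ c₂ * s ^ k) (hv : c₁ * t ^ k ≤ v) :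
    u / v ≤ c₂ / c₁ * (s / t) ^ k := by
  have hsk : 0 < s ^ k := Real.rpow_pos_of_pos hs k
  have htk : 0 < t ^ k := Real.rpow_pos_of_pos ht k
  calc u / v ≤ c₂ * s ^ k / (c₁ * t ^ k) := by gcongr
    _ = _ := by rw [Real.div_rpow hs.le ht.le]; field_simp

lemma setLIntegral_Ioi_ofReal_const_mul_rpow {D β τ : ℝ} (hD : 0 ≤ D) (hβ : 1 < β) (hτ : 0 < τ) :
    ∫⁻ σ in Set.Ioi τ, ENNReal.ofReal (D * σ ^ (-β)) =
      ENNReal.ofReal (D * (τ ^ (1 - β) / (β - 1))) := by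
  rw [← ofReal_integral_eq_lintegral_ofReal
      ((integrableOn_Ioi_rpow_of_lt (by linarith) hτ).const_mul D)
      ((ae_restrict_iff' measurableSet_Ioi).2 (.of_forall fun σ hσ =>
        mul_nonneg hD (Real.rpow_nonneg (hτ.trans hσ).le _))),
    integral_const_mul, integral_Ioi_rpow_of_lt (by linarith) hτ, neg_div, ← div_neg,
    neg_add_eq_sub, neg_sub]

/-- Lemma estB: weighted `L^q` bound for the model Volterra-type operator. -/
theorem stmt9 (ν τ₀ c₁ c₂ : ℝ) (hν : 0 < ν) (hτ₀ : 0 < τ₀) (hc₁ : 0 < c₁) (hc : c₁ ≤ c₂)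
    (κ : ℝ → ℝ) (hκcont : ContinuousOn κ (Set.Ici τ₀))
    (hκ : ∀ τ : ℝ, τ₀ ≤ τ → c₁ * τ ^ (1 + 1 / ν) ≤ κ τ ∧ κ τ ≤ c₂ * τ ^ (1 + 1 / ν))
    (a b γ : ℝ) (q : ℝ) (hq : 1 < q)
    (α : ℝ) (hα : 1 + 2 * (1 / q + max |a| |a + b|) * (1 + 1 / ν) - γ < α)
    (C₀ : ℝ) (B : ℝ → ℝ → ℝ → ℝ)
    (hBmeas : Measurable fun p : ℝ × ℝ × ℝ => B p.1 p.2.1 p.2.2)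
    (hB : ∀ τ σ ξ : ℝ, τ₀ ≤ τ → τ ≤ σ → 0 ≤ ξ → |B τ σ ξ| ≤ C₀ * σ ^ (-γ)) :
    ∃ C : ℝ, ∀ x : ℝ → ℝ → ℝ, Measurable (Function.uncurry x) →
      ∀ τ : ℝ, τ₀ < τ →
        eLpNorm (fun ξ : ℝ =>
            (∫ σ in Set.Ioi τ, B τ σ ξ * x σ ((κ τ / κ σ) ^ 2 * ξ)) * ξ ^ a * jb ξ ^ b)
            (ENNReal.ofReal q) (volume.restrict (Set.Ioi 0))
          ≤ ENNReal.ofReal (C * τ ^ (-α - γ + 1)) *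
            ⨆ σ ∈ Set.Ioi τ, ENNReal.ofReal (σ ^ α) *
              eLpNorm (fun ξ : ℝ => x σ ξ * ξ ^ a * jb ξ ^ b)
                (ENNReal.ofReal q) (volume.restrict (Set.Ioi 0)) := by
  set k := 1 + 1 / ν
  set m := max |a| |a + b|
  set e := 1 / q + m
  have hq0 : 0 < q := one_pos.trans hq
  have hk : 0 < k := by positivity
  have hc₂ : 0 < c₂ := hc₁.trans_le hc
  have hκpos : ∀ σ, τ₀ ≤ σ → 0 < κ σ := fun σ hσ =>
    (mul_pos hc₁ (Real.rpow_pos_of_pos (hτ₀.trans_le hσ) _)).trans_le (hκ σ hσ).1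
  set β := γ + α - 2 * e * k
  have hβ : 1 < β := by linarith
  set D := (|C₀| + 1) * (c₂ / c₁) ^ (2 * e)
  have hD0 : 0 < D := by positivity
  refine ⟨D / (β - 1), fun x hx τ hτ => ?_⟩
  have hτ0 : 0 < τ := hτ₀.trans hτ
  have hjb := measurable_jb
  set S := ⨆ σ ∈ Set.Ioi τ, ENNReal.ofReal (σ ^ α) *
    eLpNorm (fun ξ : ℝ => x σ ξ * ξ ^ a * jb ξ ^ b) (ENNReal.ofReal q)
      (volume.restrict (Set.Ioi 0))
  classical
  set l : ℝ → ℝ := (Set.Ioi τ).piecewise (fun σ => (κ τ / κ σ) ^ 2) (fun _ => 1)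
  have hl : ∀ σ ∈ Set.Ioi τ, l σ = (κ τ / κ σ) ^ 2 := fun σ hσ => Set.piecewise_eq_of_mem _ _ _ hσ
  have hlmeas : Measurable l := by
    refine ContinuousOn.measurable_piecewise ?_ continuousOn_const measurableSet_Ioi
    refine (continuousOn_const.div (hκcont.mono fun σ hσ => ?_) fun σ hσ => ?_).pow 2
    · exact hτ.le.trans (le_of_lt hσ)
    · exact (hκpos σ (hτ.le.trans (le_of_lt hσ))).ne'
  set f : ℝ → ℝ → ℝ≥0∞ := fun σ ξ => ENNReal.ofReal ((|C₀| + 1) * σ ^ (-γ)) *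
    (‖x σ (l σ * ξ)‖ₑ * ENNReal.ofReal (ξ ^ a * jb ξ ^ b)) with hf
  have hfmeas : Measurable (Function.uncurry f) := by
    have h : Measurable fun p : ℝ × ℝ => x p.1 (l p.1 * p.2) :=
      hx.comp (measurable_fst.prodMk ((hlmeas.comp measurable_fst).mul measurable_snd))
    simp only [hf, Function.uncurry_def]
    fun_prop
  set g : ℝ → ℝ≥0∞ := fun σ => ENNReal.ofReal (D * τ ^ (-(2 * e * k)) * σ ^ (-β))
  have hfg : ∀ σ ∈ Set.Ioi τ, ∫⁻ ξ in Set.Ioi 0, f σ ξ ^ q ≤ (g σ * S) ^ q := by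
    intro σ hσ
    have hσ' : τ < σ := hσ
    have hσ0 : 0 < σ := hτ0.trans hσ'
    have hκτ := hκpos τ hτ.le
    have hκσ := hκpos σ (hτ.trans hσ').le
    have hR : κ τ / κ σ ≤ c₂ / c₁ * (σ / τ) ^ k := by
      refine (div_le_of_rpow_bounds hc₁ hτ0 hσ0 hc₂.le (hκ τ hτ.le).2
        (hκ σ (hτ.trans hσ').le).1).trans ?_
      have : τ / σ ≤ σ / τ :=
        ((div_le_one hσ0).2 hσ'.le).trans ((one_le_div hτ0).2 hσ'.le)
      gcongr
    have hR' : κ σ / κ τ ≤ c₂ / c₁ * (σ / τ) ^ k :=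
      div_le_of_rpow_bounds hc₁ hσ0 hτ0 hc₂.le (hκ σ (hτ.trans hσ').le).2 (hκ τ hτ.le).1
    set L := (c₂ / c₁ * (σ / τ) ^ k) ^ 2 with hL
    have hl0 : 0 < l σ := by rw [hl σ hσ]; positivity
    have hlL : l σ ≤ L := by
      rw [hl σ hσ]
      exact pow_le_pow_left₀ (by positivity) hR 2
    have hlL' : (l σ)⁻¹ ≤ L := by
      rw [hl σ hσ, ← inv_pow, inv_div]
      exact pow_le_pow_left₀ (by positivity) hR' 2
    set N := eLpNorm (fun ξ : ℝ => x σ ξ * ξ ^ a * jb ξ ^ b) (ENNReal.ofReal q)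
      (volume.restrict (Set.Ioi 0))
    have hNS : N ≤ ENNReal.ofReal (σ ^ (-α)) * S := by
      have h : ENNReal.ofReal (σ ^ α) * N ≤ S := le_iSup₂_of_le σ hσ le_rfl
      calc N = ENNReal.ofReal (σ ^ (-α)) * (ENNReal.ofReal (σ ^ α) * N) := by
            rw [← mul_assoc, ← ENNReal.ofReal_mul (by positivity), ← Real.rpow_add hσ0,
              neg_add_cancel, Real.rpow_zero, ENNReal.ofReal_one, one_mul]
        _ ≤ _ := by gcongr
    have hLe : L ^ e = (c₂ / c₁) ^ (2 * e) * (σ ^ (2 * e * k) * τ ^ (-(2 * e * k))) := by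
      rw [hL, ← Real.rpow_natCast, ← Real.rpow_mul (by positivity), Nat.cast_ofNat,
        Real.mul_rpow (by positivity) (by positivity), ← Real.rpow_mul (by positivity),
        mul_comm k, Real.div_rpow hσ0.le hτ0.le, Real.rpow_neg hτ0.le, div_eq_mul_inv (σ ^ _)]
    have hgσ : (|C₀| + 1) * σ ^ (-γ) * L ^ e * σ ^ (-α) =
        D * τ ^ (-(2 * e * k)) * σ ^ (-β) := by
      have hσβ : σ ^ (-β) = σ ^ (-γ) * σ ^ (2 * e * k) * σ ^ (-α) := by
        rw [← Real.rpow_add hσ0, ← Real.rpow_add hσ0]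
        congr 1
        ring
      rw [hLe, hσβ]
      ring
    calc ∫⁻ ξ in Set.Ioi 0, f σ ξ ^ q
        = ENNReal.ofReal ((|C₀| + 1) * σ ^ (-γ)) ^ q * ∫⁻ ξ in Set.Ioi 0,
            (‖x σ (l σ * ξ)‖ₑ * ENNReal.ofReal (ξ ^ a * jb ξ ^ b)) ^ q := by
          simp only [hf, ENNReal.mul_rpow_of_nonneg _ _ hq0.le]
          have h : Measurable fun ξ => x σ (l σ * ξ) :=
            hx.of_uncurry_left.comp (measurable_const_mul _)
          rw [lintegral_const_mul _ (by fun_prop)]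
      _ ≤ ENNReal.ofReal ((|C₀| + 1) * σ ^ (-γ)) ^ q * (ENNReal.ofReal (L ^ e) * N) ^ q := by
          gcongr
          exact lintegral_comp_mul_weight_rpow_le hq hl0 hlL hlL' hx.of_uncurry_left
      _ ≤ ENNReal.ofReal ((|C₀| + 1) * σ ^ (-γ)) ^ q *
            (ENNReal.ofReal (L ^ e) * (ENNReal.ofReal (σ ^ (-α)) * S)) ^ q := by gcongr
      _ = (g σ * S) ^ q := by
          rw [← ENNReal.mul_rpow_of_nonneg _ _ hq0.le, ← mul_assoc, ← mul_assoc,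
            ← ENNReal.ofReal_mul (by positivity), ← ENNReal.ofReal_mul (by positivity), hgσ]
  have hmink : ∫⁻ ξ in Set.Ioi 0, (∫⁻ σ in Set.Ioi τ, f σ ξ) ^ q ≤
      ((∫⁻ σ in Set.Ioi τ, g σ) * S) ^ q := by
    refine lintegral_lintegral_rpow_le hq hfmeas (by fun_prop) ?_
      (.of_forall fun σ => ENNReal.ofReal_ne_top) ?_
    · filter_upwards [ae_restrict_mem measurableSet_Ioi] with σ hσ
      have hσ0 : 0 < σ := hτ0.trans hσ
      exact (ENNReal.ofReal_pos.2 (by positivity)).ne'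
    · filter_upwards [ae_restrict_mem measurableSet_Ioi] with σ hσ using hfg σ hσ
  have hgint : ∫⁻ σ in Set.Ioi τ, g σ = ENNReal.ofReal (D / (β - 1) * τ ^ (-α - γ + 1)) := by
    rw [setLIntegral_Ioi_ofReal_const_mul_rpow (by positivity) hβ hτ0]
    congr 1
    rw [show -α - γ + 1 = -(2 * e * k) + (1 - β) by ring, Real.rpow_add hτ0]
    ring
  rw [← hgint, eLpNorm_eq_lintegral_rpow_enorm_toReal (by simpa using hq0) ENNReal.ofReal_ne_top,
    ENNReal.toReal_ofReal hq0.le, one_div, ENNReal.rpow_inv_le_iff hq0]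
  refine (setLIntegral_mono' measurableSet_Ioi fun ξ hξ => ?_).trans hmink
  have hξ : 0 < ξ := hξ
  have hw : 0 ≤ ξ ^ a * jb ξ ^ b :=
    mul_nonneg (Real.rpow_nonneg hξ.le _) (Real.rpow_nonneg (jb_pos ξ).le _)
  refine ENNReal.rpow_le_rpow ?_ hq0.le
  rw [mul_assoc, enorm_mul, Real.enorm_of_nonneg hw]
  calc _ ≤ (∫⁻ σ in Set.Ioi τ, ‖B τ σ ξ * x σ ((κ τ / κ σ) ^ 2 * ξ)‖ₑ) *
          ENNReal.ofReal (ξ ^ a * jb ξ ^ b) := by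
        gcongr
        exact enorm_integral_le_lintegral_enorm _
    _ = ∫⁻ σ in Set.Ioi τ, ‖B τ σ ξ * x σ ((κ τ / κ σ) ^ 2 * ξ)‖ₑ *
          ENNReal.ofReal (ξ ^ a * jb ξ ^ b) :=
        (lintegral_mul_const' _ _ ENNReal.ofReal_ne_top).symm
    _ ≤ ∫⁻ σ in Set.Ioi τ, f σ ξ := by
        refine setLIntegral_mono' measurableSet_Ioi fun σ hσ => ?_
        have hσ0 : 0 < σ := hτ0.trans hσ
        simp only [hf, hl σ hσ]
        rw [enorm_mul, mul_assoc]
        gcongr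
        rw [← ofReal_norm, Real.norm_eq_abs]
        refine ENNReal.ofReal_le_ofReal ((hB τ σ ξ hτ.le (le_of_lt hσ) hξ.le).trans ?_)
        gcongr
        linarith [le_abs_self C₀]
end
end

section
/- In the setting of the diagonal-decomposition lemmas (kernels K₁^ε, K₂^ε, K₃^ε obtained from the diagonally truncated transference kernel K^d_{n₀} by restricting the first variable to [0,ε), to the middle range, and to (ε^{-1},∞) respectively, and operators 𝓐_ε, 𝓑_ε, 𝓒_ε defined by 𝓐_ε x(τ,ξ) := 2∫_τ^∞ Ĥ_c(τ,σ,ξ)β(σ)∫₀^∞ K₁^ε((κ(τ)/κ(σ))²ξ,η)x(σ,η)dη dσ and analogously for K₂^ε, K₃^ε, with κ nondecreasing so that κ(τ)/κ(σ) ≤ 1 for τ ≤ σ): for any sufficiently small ε > 0, any n₀ ≥ 4, and μ := 1 + 4/n₀, one has the operator identities 𝓐_ε ∘ 𝓑_{με} = 0, 𝓑_{με} ∘ 𝓒_ε = 0, and 𝓐_ε ∘ 𝓒_ε = 𝓐_{με} ∘ 𝓒_ε = 𝓐_ε ∘ 𝓒_{με} = 0; equivalently, the corresponding iterated kernels vanish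 identically, e.g. K₁^ε(ξ,η₁) K₂^{με}(ω²η₁, η₂) = 0 for all ξ, η₁, η₂ ≥ 0 and all ω ∈ (0,1]. -/
open MeasureTheory Filter

noncomputable section

/-- `β(τ) = κ'(τ)/κ(τ)`. -/
def betaFn (κ : ℝ → ℝ) (τ : ℝ) : ℝ := deriv κ τ / κ τ

/-- The transference kernel `K_cc(ξ,η) = ρ(η)F(ξ,η)/(ξ−η)`. -/
def Kcc (ρ : ℝ → ℝ) (F : ℝ → ℝ → ℝ) (ξ η : ℝ) : ℝ := ρ η * F ξ η / (ξ - η)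

/-- The diagonal part `K^d_{n₀}` of the transference kernel. -/
def Kd (χ ρ : ℝ → ℝ) (F : ℝ → ℝ → ℝ) (n₀ : ℕ) (ξ η : ℝ) : ℝ :=
  χ ((n₀ : ℝ) * (ξ / η - 1)) * Kcc ρ F ξ η

/-- The off-diagonal part `K^{nd}_{n₀}` of the transference kernel. -/
def Knd (χ ρ : ℝ → ℝ) (F : ℝ → ℝ → ℝ) (n₀ : ℕ) (ξ η : ℝ) : ℝ :=
  (1 - χ ((n₀ : ℝ) * (ξ / η - 1))) * Kcc ρ F ξ η

/-- The norm `‖f‖_Y = ‖f‖_{L^p(0,∞)} + ‖⟨·⟩^{1/8} f‖_{L²_ρ(0,∞)}`. -/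
def Ynorm (ρ : ℝ → ℝ) (p : ℝ) (f : ℝ → ℝ) : ENNReal :=
  eLpNorm f (ENNReal.ofReal p) (volume.restrict (Set.Ioi 0)) +
  eLpNorm (fun ξ => jb ξ ^ ((1 : ℝ) / 8) * f ξ) 2
    ((volume.restrict (Set.Ioi 0)).withDensity fun ξ => ENNReal.ofReal (ρ ξ))

/-- The norm `‖x‖_{𝓨^α} = sup_{τ>τ₀} τ^α ‖x(τ,·)‖_Y`. -/
def Ysup (ρ : ℝ → ℝ) (p τ₀ α : ℝ) (x : ℝ → ℝ → ℝ) : ENNReal :=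
  ⨆ τ ∈ Set.Ioi τ₀, ENNReal.ofReal (τ ^ α) * Ynorm ρ p (x τ)

/-- Hypotheses on the rescaling function `κ`. -/
def KappaSetting (ν τ₀ c₁ c₂ : ℝ) (κ cfn : ℝ → ℝ) : Prop :=
  ContDiffOn ℝ 1 κ (Set.Ici τ₀) ∧
  (∀ τ : ℝ, τ₀ ≤ τ → c₁ * τ ^ (1 + 1 / ν) ≤ κ τ ∧ κ τ ≤ c₂ * τ ^ (1 + 1 / ν)) ∧
  (∀ τ : ℝ, τ₀ ≤ τ →
    cfn τ ∈ Set.Icc (1 / 2 : ℝ) 2 ∧ betaFn κ τ = cfn τ * (1 + 1 / ν) / τ)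

/-- Hypotheses on the spectral density `ρ`. -/
def RhoSetting (d₁ d₂ d₃ : ℝ) (ρ : ℝ → ℝ) : Prop :=
  ContDiffOn ℝ 1 ρ (Set.Ioi 0) ∧
  (∀ ξ : ℝ, 0 < ξ → 0 < ρ ξ) ∧
  (∀ ξ : ℝ, 0 < ξ → ξ ≤ 1 →
    d₁ * ξ ^ (-(1 : ℝ) / 2) ≤ ρ ξ ∧ ρ ξ ≤ d₂ * ξ ^ (-(1 : ℝ) / 2)) ∧
  (∀ ξ : ℝ, 1 ≤ ξ → d₁ * ξ ^ ((1 : ℝ) / 2) ≤ ρ ξ ∧ ρ ξ ≤ d₂ * ξ ^ ((1 : ℝ) / 2)) ∧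
  (∀ ξ : ℝ, 0 < ξ → |deriv ρ ξ| ≤ d₃ * ρ ξ / ξ)

/-- Hypotheses on the transference function `F`: symmetry, `C²` regularity and the size
and derivative bounds of Theorem `thm:K`. -/
def FSetting (CF : ℕ → ℝ) (F : ℝ → ℝ → ℝ) : Prop :=
  (∀ ξ η : ℝ, F ξ η = F η ξ) ∧
  ContDiffOn ℝ 2 (Function.uncurry F) (Set.Ioi 0 ×ˢ Set.Ioi 0) ∧
  (∀ N : ℕ, ∀ ξ η : ℝ, 0 < ξ → 0 < η →
    (ξ + η ≤ 1 → |F ξ η| ≤ CF N * (ξ + η)) ∧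
    (1 ≤ ξ + η → |F ξ η| ≤ CF N * (ξ + η)⁻¹ *
      (1 + |Real.sqrt ξ - Real.sqrt η|) ^ (-(N : ℝ)))) ∧
  (∀ N : ℕ, ∀ ξ η : ℝ, 0 < ξ → 0 < η →
    (ξ + η ≤ 1 → |deriv (fun s => F s η) ξ| + |deriv (fun s => F ξ s) η| ≤ CF N) ∧
    (1 ≤ ξ + η → |deriv (fun s => F s η) ξ| + |deriv (fun s => F ξ s) η|
      ≤ CF N * (ξ + η) ^ (-(3 : ℝ) / 2) *
          (1 + |Real.sqrt ξ - Real.sqrt η|) ^ (-(N : ℝ)))) ∧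
  (∀ N : ℕ, ∀ ξ η : ℝ, 0 < ξ → 0 < η →
    (ξ + η ≤ 1 →
      |deriv (fun s => deriv (fun u => F u η) s) ξ| +
        |deriv (fun s => deriv (fun u => F ξ u) s) η| +
        |deriv (fun s => deriv (fun u => F s u) η) ξ|
        ≤ CF N * (ξ + η) ^ (-(1 : ℝ) / 2)) ∧
    (1 ≤ ξ + η →
      |deriv (fun s => deriv (fun u => F u η) s) ξ| +
        |deriv (fun s => deriv (fun u => F ξ u) s) η| +
        |deriv (fun s => deriv (fun u => F s u) η) ξ|
        ≤ CF N * (ξ + η) ^ (-(2 : ℝ)) *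
            (1 + |Real.sqrt ξ - Real.sqrt η|) ^ (-(N : ℝ))))

/-- Hypotheses on the cutoff `χ`. -/
def CutoffFn (χ : ℝ → ℝ) : Prop :=
  ContDiff ℝ (⊤ : ℕ∞) χ ∧ (∀ x : ℝ, |x| ≤ 1 → χ x = 1) ∧ (∀ x : ℝ, 2 ≤ |x| → χ x = 0)

/-- Principal value of `∫₀^∞ f(η) dη` at the singular point `s`. -/
def pvI (f : ℝ → ℝ) (s : ℝ) : ℝ :=
  limUnder (nhdsWithin (0 : ℝ) (Set.Ioi 0))
    (fun δ => ∫ η in {η : ℝ | 0 < η ∧ δ ≤ |η - s|}, f η)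

/-- The sandwiched operator `2 ∫_τ^∞ Ĥ_c β (p.v. ∫₀^∞ K(ω²ξ,·) x(σ,·)) dσ` for a kernel `K`. -/
def Sop (κ ρ : ℝ → ℝ) (K : ℝ → ℝ → ℝ) (x : ℝ → ℝ → ℝ) (τ ξ : ℝ) : ℝ :=
  2 * ∫ σ in Set.Ioi τ, Hhat κ ρ τ σ ξ * betaFn κ σ *
    pvI (fun η => K ((κ τ / κ σ) ^ 2 * ξ) η * x σ η) ((κ τ / κ σ) ^ 2 * ξ)

/-- `K₁^ε`: the diagonal kernel restricted to first variable in `[0,ε)`. -/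
def K1 (χ ρ : ℝ → ℝ) (F : ℝ → ℝ → ℝ) (n₀ : ℕ) (ε ξ η : ℝ) : ℝ :=
  if ξ < ε then Kd χ ρ F n₀ ξ η else 0

/-- `K₃^ε`: the diagonal kernel restricted to first variable in `(ε⁻¹,∞)`. -/
def K3 (χ ρ : ℝ → ℝ) (F : ℝ → ℝ → ℝ) (n₀ : ℕ) (ε ξ η : ℝ) : ℝ :=
  if ε⁻¹ < ξ then Kd χ ρ F n₀ ξ η else 0

/-- `K₂^ε = K^d_{n₀} − K₁^ε − K₃^ε`. -/
def K2 (χ ρ : ℝ → ℝ) (F : ℝ → ℝ → ℝ) (n₀ : ℕ) (ε ξ η : ℝ) : ℝ :=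
  Kd χ ρ F n₀ ξ η - K1 χ ρ F n₀ ε ξ η - K3 χ ρ F n₀ ε ξ η

theorem pvI_eq_zero {f : ℝ → ℝ} (hf : ∀ η, 0 < η → f η = 0) (s : ℝ) : pvI f s = 0 := by
  have h : (fun δ : ℝ => ∫ η in {η : ℝ | 0 < η ∧ δ ≤ |η - s|}, f η) = fun _ => 0 :=
    funext fun δ => setIntegral_eq_zero_of_forall_eq_zero fun η hη => hf η hη.1
  rw [pvI, h]
  exact tendsto_const_nhds.limUnder_eq

theorem Sop_eq_zero {κ ρ : ℝ → ℝ} {K x : ℝ → ℝ → ℝ} {τ ξ : ℝ}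
    (h : ∀ σ, τ < σ → ∀ η, 0 < η → K ((κ τ / κ σ) ^ 2 * ξ) η * x σ η = 0) :
    Sop κ ρ K x τ ξ = 0 := by
  rw [Sop, setIntegral_eq_zero_of_forall_eq_zero, mul_zero]
  intro σ hσ
  rw [pvI_eq_zero (h σ hσ), mul_zero]

/-- Two sandwiched operators compose to zero when their iterated kernel vanishes. -/
theorem Sop_Sop_eq_zero {κ : ℝ → ℝ} (hmono : Monotone κ) (hκpos : ∀ τ, 0 < κ τ) (ρ : ℝ → ℝ)
    {K L : ℝ → ℝ → ℝ}
    (h : ∀ a η b ω, 0 ≤ η → 0 < ω → ω ≤ 1 → K a η * L (ω ^ 2 * η) b = 0)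
    (x : ℝ → ℝ → ℝ) (τ ξ : ℝ) : Sop κ ρ K (Sop κ ρ L x) τ ξ = 0 := by
  refine Sop_eq_zero fun σ _ η hη => ?_
  by_cases hK : K ((κ τ / κ σ) ^ 2 * ξ) η = 0
  · rw [hK, zero_mul]
  · rw [Sop_eq_zero, mul_zero]
    intro σ' hσ' b _
    have hL := h ((κ τ / κ σ) ^ 2 * ξ) η b (κ σ / κ σ') hη.le (div_pos (hκpos σ) (hκpos σ'))
      ((div_le_one (hκpos σ')).2 (hmono hσ'.le))
    rw [(mul_eq_zero.1 hL).resolve_left hK, zero_mul]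

/-- On the support of the diagonal kernel the second variable is positive and at most
`1 + 4/n₀` times the first. -/
theorem lt_of_Kd_ne_zero {χ ρ : ℝ → ℝ} {F : ℝ → ℝ → ℝ} {n₀ : ℕ} (hχ : CutoffFn χ) (hn : 4 ≤ n₀)
    {a η : ℝ} (hη : 0 ≤ η) (h : Kd χ ρ F n₀ a η ≠ 0) :
    0 < η ∧ η < (1 + 4 / (n₀ : ℝ)) * a := by
  have hn' : (4 : ℝ) ≤ n₀ := by exact_mod_cast hn
  have hχ0 : χ ((n₀ : ℝ) * (a / η - 1)) ≠ 0 := left_ne_zero_of_mul h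
  have habs : |(n₀ : ℝ) * (a / η - 1)| < 2 := by
    by_contra! hc
    exact hχ0 (hχ.2.2 _ hc)
  have hlow := (abs_lt.1 habs).1
  have hpos : 0 < η := by
    refine hη.lt_of_ne' fun h0 => ?_
    rw [h0, div_zero] at hlow
    linarith
  refine ⟨hpos, ?_⟩
  have ha : (n₀ - 2) * η < n₀ * a := by
    have h2 := mul_lt_mul_of_pos_right hlow hpos
    have h3 : (n₀ : ℝ) * (a / η - 1) * η = n₀ * a - n₀ * η := by field_simp
    linarith
  have hn0 : (0 : ℝ) < n₀ := by linarith
  have key : (n₀ : ℝ) ^ 2 * η < (n₀ + 4) * (n₀ * a) := by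
    nlinarith [mul_lt_mul_of_pos_left ha (by linarith : (0 : ℝ) < n₀ + 4),
      mul_nonneg (by linarith : (0 : ℝ) ≤ n₀ - 4) hη]
  have h4 : (1 + 4 / (n₀ : ℝ)) * a = (n₀ + 4) * (n₀ * a) / (n₀ : ℝ) ^ 2 := by field_simp
  rw [h4, lt_div_iff₀ (by positivity)]
  linarith

theorem K1_ne_zero {χ ρ : ℝ → ℝ} {F : ℝ → ℝ → ℝ} {n₀ : ℕ} {ε a η : ℝ}
    (h : K1 χ ρ F n₀ ε a η ≠ 0) : a < ε ∧ Kd χ ρ F n₀ a η ≠ 0 := by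
  unfold K1 at h
  split_ifs at h with ha
  exacts [⟨ha, h⟩, absurd rfl h]

theorem K2_ne_zero {χ ρ : ℝ → ℝ} {F : ℝ → ℝ → ℝ} {n₀ : ℕ} {ε a η : ℝ} (hε : ε ≤ ε⁻¹)
    (h : K2 χ ρ F n₀ ε a η ≠ 0) : ε ≤ a ∧ a ≤ ε⁻¹ ∧ Kd χ ρ F n₀ a η ≠ 0 := by
  unfold K2 K1 K3 at h
  by_cases h1 : a < ε
  · have h3 : ¬ ε⁻¹ < a := by linarith
    simp [h1, h3] at h
  · by_cases h3 : ε⁻¹ < a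
    · simp [h1, h3] at h
    · simp only [h1, h3, if_false, sub_zero] at h
      exact ⟨not_lt.1 h1, not_lt.1 h3, h⟩

theorem K3_ne_zero {χ ρ : ℝ → ℝ} {F : ℝ → ℝ → ℝ} {n₀ : ℕ} {ε a η : ℝ}
    (h : K3 χ ρ F n₀ ε a η ≠ 0) : ε⁻¹ < a := by
  unfold K3 at h
  split_ifs at h with ha
  exacts [ha, absurd rfl h]

theorem K1_mul_K2_eq_zero {χ ρ : ℝ → ℝ} {F : ℝ → ℝ → ℝ} {n₀ : ℕ} (hχ : CutoffFn χ) (hn : 4 ≤ n₀)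
    {ε : ℝ} (hε : (1 + 4 / (n₀ : ℝ)) * ε ≤ ((1 + 4 / (n₀ : ℝ)) * ε)⁻¹)
    (a η b ω : ℝ) (hη : 0 ≤ η) (hω : 0 < ω) (hω1 : ω ≤ 1) :
    K1 χ ρ F n₀ ε a η * K2 χ ρ F n₀ ((1 + 4 / (n₀ : ℝ)) * ε) (ω ^ 2 * η) b = 0 := by
  by_contra! h
  obtain ⟨ha, hK⟩ := K1_ne_zero (left_ne_zero_of_mul h)
  obtain ⟨hlow, -, -⟩ := K2_ne_zero hε (right_ne_zero_of_mul h)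
  have hlt := (lt_of_Kd_ne_zero hχ hn hη hK).2
  have hμa := mul_lt_mul_of_pos_left ha (by positivity : 0 < 1 + 4 / (n₀ : ℝ))
  have hle := mul_le_of_le_one_left hη (pow_le_one₀ hω.le hω1 : ω ^ 2 ≤ 1)
  linarith

theorem K2_mul_K3_eq_zero {χ ρ : ℝ → ℝ} {F : ℝ → ℝ → ℝ} {n₀ : ℕ} (hχ : CutoffFn χ) (hn : 4 ≤ n₀)
    {ε : ℝ} (hε : (1 + 4 / (n₀ : ℝ)) * ε ≤ ((1 + 4 / (n₀ : ℝ)) * ε)⁻¹)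
    (a η b ω : ℝ) (hη : 0 ≤ η) (hω : 0 < ω) (hω1 : ω ≤ 1) :
    K2 χ ρ F n₀ ((1 + 4 / (n₀ : ℝ)) * ε) a η * K3 χ ρ F n₀ ε (ω ^ 2 * η) b = 0 := by
  by_contra! h
  obtain ⟨-, ha, hK⟩ := K2_ne_zero hε (left_ne_zero_of_mul h)
  have hgt := K3_ne_zero (right_ne_zero_of_mul h)
  have hlt := (lt_of_Kd_ne_zero hχ hn hη hK).2
  have hμ : 0 < 1 + 4 / (n₀ : ℝ) := by positivity
  have hμa := mul_le_mul_of_nonneg_left ha hμ.le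
  rw [mul_inv, mul_inv_cancel_left₀ hμ.ne'] at hμa
  have hle := mul_le_of_le_one_left hη (pow_le_one₀ hω.le hω1 : ω ^ 2 ≤ 1)
  linarith

theorem K1_mul_K3_eq_zero {χ ρ : ℝ → ℝ} {F : ℝ → ℝ → ℝ} {n₀ : ℕ} (hχ : CutoffFn χ) (hn : 4 ≤ n₀)
    {ε ε' : ℝ} (hε : (1 + 4 / (n₀ : ℝ)) * ε ≤ ε'⁻¹)
    (a η b ω : ℝ) (hη : 0 ≤ η) (hω : 0 < ω) (hω1 : ω ≤ 1) :
    K1 χ ρ F n₀ ε a η * K3 χ ρ F n₀ ε' (ω ^ 2 * η) b = 0 := by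
  by_contra! h
  obtain ⟨ha, hK⟩ := K1_ne_zero (left_ne_zero_of_mul h)
  have hgt := K3_ne_zero (right_ne_zero_of_mul h)
  have hlt := (lt_of_Kd_ne_zero hχ hn hη hK).2
  have hμa := mul_lt_mul_of_pos_left ha (by positivity : 0 < 1 + 4 / (n₀ : ℝ))
  have hle := mul_le_of_le_one_left hη (pow_le_one₀ hω.le hω1 : ω ^ 2 ≤ 1)
  linarith

/-- Lemma orth: the orthogonality relations between `𝓐`, `𝓑`, `𝓒`. -/
theorem stmt16 (ν : ℝ) (hν : 0 < ν) (τ₀ : ℝ) (hτ₀ : 1 ≤ τ₀)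
    (c₁ c₂ d₁ d₂ d₃ : ℝ) (hc₁ : 0 < c₁) (hc : c₁ ≤ c₂) (hd₁ : 0 < d₁) (hd : d₁ ≤ d₂)
    (κ cfn ρ : ℝ → ℝ) (F : ℝ → ℝ → ℝ) (χ : ℝ → ℝ) (CF : ℕ → ℝ)
    (hκ : KappaSetting ν τ₀ c₁ c₂ κ cfn) (hρ : RhoSetting d₁ d₂ d₃ ρ)
    (hF : FSetting CF F) (hχ : CutoffFn χ)
    -- κ is nondecreasing and positive, so that κ(τ)/κ(σ) ∈ (0,1] for τ ≤ σ
    (hmono : Monotone κ) (hκpos : ∀ τ : ℝ, 0 < κ τ) :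
    ∃ εstar > (0 : ℝ), ∀ ε : ℝ, 0 < ε → ε < εstar →
    ∀ n₀ : ℕ, 4 ≤ n₀ →
      -- operator identities, with μ := 1 + 4/n₀
      (∀ x : ℝ → ℝ → ℝ, ∀ τ ξ : ℝ,
        Sop κ ρ (K1 χ ρ F n₀ ε) (Sop κ ρ (K2 χ ρ F n₀ ((1 + 4 / (n₀ : ℝ)) * ε)) x) τ ξ = 0 ∧
        Sop κ ρ (K2 χ ρ F n₀ ((1 + 4 / (n₀ : ℝ)) * ε)) (Sop κ ρ (K3 χ ρ F n₀ ε) x) τ ξ = 0 ∧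
        Sop κ ρ (K1 χ ρ F n₀ ε) (Sop κ ρ (K3 χ ρ F n₀ ε) x) τ ξ = 0 ∧
        Sop κ ρ (K1 χ ρ F n₀ ((1 + 4 / (n₀ : ℝ)) * ε)) (Sop κ ρ (K3 χ ρ F n₀ ε) x) τ ξ = 0 ∧
        Sop κ ρ (K1 χ ρ F n₀ ε) (Sop κ ρ (K3 χ ρ F n₀ ((1 + 4 / (n₀ : ℝ)) * ε)) x) τ ξ = 0) ∧
      -- the corresponding kernel identity
      (∀ ξ η₁ η₂ ω : ℝ, 0 ≤ ξ → 0 ≤ η₁ → 0 ≤ η₂ → 0 < ω → ω ≤ 1 →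
        K1 χ ρ F n₀ ε ξ η₁ *
          K2 χ ρ F n₀ ((1 + 4 / (n₀ : ℝ)) * ε) (ω ^ 2 * η₁) η₂ = 0) := by
  refine ⟨1 / 2, by norm_num, fun ε hε hε1 n₀ hn => ?_⟩
  have hμ2 : 1 + 4 / (n₀ : ℝ) ≤ 2 := by
    have hn' : (4 : ℝ) ≤ n₀ := by exact_mod_cast hn
    have := (div_le_one (by linarith : (0 : ℝ) < n₀)).2 hn'
    linarith
  have hμε : 0 < (1 + 4 / (n₀ : ℝ)) * ε := by positivity
  have hμε1 : (1 + 4 / (n₀ : ℝ)) * ε ≤ 1 := by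
    linarith [mul_le_mul_of_nonneg_right hμ2 hε.le]
  have h1 : (1 + 4 / (n₀ : ℝ)) * ε ≤ ((1 + 4 / (n₀ : ℝ)) * ε)⁻¹ :=
    hμε1.trans ((one_le_inv₀ hμε).2 hμε1)
  have h2 : 2 ≤ ε⁻¹ := (le_inv_comm₀ two_pos hε).2 (by linarith)
  have h3 : (1 + 4 / (n₀ : ℝ)) * ((1 + 4 / (n₀ : ℝ)) * ε) ≤ ε⁻¹ := by
    linarith [mul_le_mul hμ2 hμε1 hμε.le two_pos.le]
  exact ⟨fun x τ ξ =>
    ⟨Sop_Sop_eq_zero hmono hκpos ρ (K1_mul_K2_eq_zero hχ hn h1) x τ ξ,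
      Sop_Sop_eq_zero hmono hκpos ρ (K2_mul_K3_eq_zero hχ hn h1) x τ ξ,
      Sop_Sop_eq_zero hmono hκpos ρ (K1_mul_K3_eq_zero hχ hn (by linarith)) x τ ξ,
      Sop_Sop_eq_zero hmono hκpos ρ (K1_mul_K3_eq_zero hχ hn h3) x τ ξ,
      Sop_Sop_eq_zero hmono hκpos ρ (K1_mul_K3_eq_zero hχ hn h1) x τ ξ⟩,
    fun ξ η₁ η₂ ω _ hη₁ _ hω hω1 => K1_mul_K2_eq_zero hχ hn h1 ξ η₁ η₂ ω hη₁ hω hω1⟩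
end
end
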